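/- arXiv:2603.29885 — 2 statements merged into one kernel-verified Lean document; each statement's English description precedes it below -/
import Mathlib

section
/- Let f, g ∈ C(Ω × ℝ). Let u ∈ USC(Ω) be a viscosity subsolution of F(x,D²u) = f(x,u) in Ω and v ∈ LSC(Ω) a viscosity supersolution of F(x,D²v) = g(x,v) in Ω. Then the difference w = u − v is a viscosity subsolution of 𝓜⁺(D²w) ≥ f(x,u) − g(x,v) in Ω. -/
open scoped Matrix Topology
open Bornology MeasureTheory

noncomputable section

/-- Euclidean space `ℝ^N`. -/
abbrev Euc (N : ℕ) := EuclideanSpace ℝ (Fin N)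

/-- The Hessian matrix of a (test) function `φ` at `x`, with entries the second
partial derivatives in the coordinate directions. -/
def hessianMatrix {N : ℕ} (φ : Euc N → ℝ) (x : Euc N) : Matrix (Fin N) (Fin N) ℝ :=
  Matrix.of fun i j =>
    iteratedFDeriv ℝ 2 φ x ![EuclideanSpace.single i (1 : ℝ), EuclideanSpace.single j (1 : ℝ)]

/-- Loewner (partial) order on real square matrices: `A ≤ B` iff `B - A` is positive
semidefinite. -/
def MatLE {n : Type*} [Fintype n] (A B : Matrix n n ℝ) : Prop := (B - A).PosSemidef

/-- `u` is a viscosity subsolution of `G(x, u, D²u) ≥ 0` on `Ω`: at any interior point where a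
`C²` function `φ` touches `u` from above, `G(x₀, u(x₀), D²φ(x₀)) ≥ 0`. -/
def ViscSubsol {N : ℕ} (Ω : Set (Euc N))
    (G : Euc N → ℝ → Matrix (Fin N) (Fin N) ℝ → ℝ) (u : Euc N → ℝ) : Prop :=
  ∀ x₀ ∈ Ω, ∀ φ : Euc N → ℝ, ContDiff ℝ 2 φ → u x₀ = φ x₀ →
    IsLocalMaxOn (fun x => u x - φ x) Ω x₀ →
    0 ≤ G x₀ (u x₀) (hessianMatrix φ x₀)

/-- `u` is a viscosity supersolution of `G(x, u, D²u) ≤ 0` on `Ω`: at any interior point where a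
`C²` function `φ` touches `u` from below, `G(x₀, u(x₀), D²φ(x₀)) ≤ 0`. -/
def ViscSupersol {N : ℕ} (Ω : Set (Euc N))
    (G : Euc N → ℝ → Matrix (Fin N) (Fin N) ℝ → ℝ) (u : Euc N → ℝ) : Prop :=
  ∀ x₀ ∈ Ω, ∀ φ : Euc N → ℝ, ContDiff ℝ 2 φ → u x₀ = φ x₀ →
    IsLocalMinOn (fun x => u x - φ x) Ω x₀ →
    G x₀ (u x₀) (hessianMatrix φ x₀) ≤ 0

/-- (F1): uniform ellipticity with ellipticity constants `0 < lam ≤ Lam`. -/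
def IsF1 {N : ℕ} (Ω : Set (Euc N)) (F : Euc N → Matrix (Fin N) (Fin N) ℝ → ℝ)
    (lam Lam : ℝ) : Prop :=
  0 < lam ∧ lam ≤ Lam ∧
    ∀ x ∈ Ω, ∀ X P : Matrix (Fin N) (Fin N) ℝ, X.IsSymm → P.PosSemidef →
      lam * P.trace ≤ F x (X + P) - F x X ∧ F x (X + P) - F x X ≤ Lam * P.trace

/-- (F2): positive 1-homogeneity in the matrix variable. -/
def IsF2 {N : ℕ} (Ω : Set (Euc N)) (F : Euc N → Matrix (Fin N) (Fin N) ℝ → ℝ) : Prop :=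
  ∀ x ∈ Ω, ∀ t : ℝ, 0 ≤ t → ∀ X : Matrix (Fin N) (Fin N) ℝ, F x (t • X) = t * F x X

/-- (F3): the standard structure condition of viscosity solution theory, with a modulus of
continuity `ω`. -/
def IsF3 {N : ℕ} (Ω : Set (Euc N)) (F : Euc N → Matrix (Fin N) (Fin N) ℝ → ℝ) : Prop :=
  ∃ ω : ℝ → ℝ, Monotone ω ∧ ω 0 = 0 ∧ ContinuousAt ω 0 ∧ (∀ t, 0 ≤ ω t) ∧
    ∀ α : ℝ, 0 < α → ∀ x ∈ Ω, ∀ y ∈ Ω, ∀ X Y : Matrix (Fin N) (Fin N) ℝ,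
      X.IsSymm → Y.IsSymm →
      MatLE ((-(3 * α)) • (1 : Matrix (Fin N ⊕ Fin N) (Fin N ⊕ Fin N) ℝ))
        (Matrix.fromBlocks X 0 0 (-Y)) →
      MatLE (Matrix.fromBlocks X 0 0 (-Y))
        ((3 * α) • Matrix.fromBlocks 1 (-1) (-1) 1) →
      F x X - F y Y ≤ ω (α * ‖x - y‖ ^ 2 + ‖x - y‖)

/-- Continuity of `F` on `Ω × 𝒮_N`. -/
def FCont {N : ℕ} (Ω : Set (Euc N)) (F : Euc N → Matrix (Fin N) (Fin N) ℝ → ℝ) : Prop :=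
  ContinuousOn (fun q : Euc N × Matrix (Fin N) (Fin N) ℝ => F q.1 q.2) (Ω ×ˢ Set.univ)

/-- A bounded domain (open, bounded, nonempty, connected set) of class `C²`, described by a
`C²` defining function with nonvanishing gradient on the boundary. -/
def IsC2Domain {N : ℕ} (Ω : Set (Euc N)) : Prop :=
  IsOpen Ω ∧ IsBounded Ω ∧ Ω.Nonempty ∧ IsConnected Ω ∧
    ∃ f : Euc N → ℝ, ContDiff ℝ 2 f ∧ Ω = {x | f x < 0} ∧
      frontier Ω = {x | f x = 0} ∧ ∀ x ∈ frontier Ω, fderiv ℝ f x ≠ 0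

/-- The operator `F(x, M) + μ r` of the eigenvalue problem. -/
def eigenG {N : ℕ} (F : Euc N → Matrix (Fin N) (Fin N) ℝ → ℝ) (μ : ℝ) :
    Euc N → ℝ → Matrix (Fin N) (Fin N) ℝ → ℝ :=
  fun x r M => F x M + μ * r

/-- The principal eigenvalue (à la Berestycki–Nirenberg–Varadhan) of `F` on `D`:
`λ₁⁺(D) = sup {μ : ∃ ψ > 0 in D, F(x, D²ψ) + μψ ≤ 0 in D in the viscosity sense}`. -/
def principalEigenvalue {N : ℕ} (F : Euc N → Matrix (Fin N) (Fin N) ℝ → ℝ)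
    (D : Set (Euc N)) : ℝ :=
  sSup {μ : ℝ | ∃ ψ : Euc N → ℝ, (∀ x ∈ D, 0 < ψ x) ∧ ViscSupersol D (eigenG F μ) ψ}

/-- The logistic operator `F(x, M) + μ r - k(x) r^p`. -/
def logisticG {N : ℕ} (F : Euc N → Matrix (Fin N) (Fin N) ℝ → ℝ) (μ : ℝ)
    (k : Euc N → ℝ) (p : ℝ) : Euc N → ℝ → Matrix (Fin N) (Fin N) ℝ → ℝ :=
  fun x r M => F x M + μ * r - k x * Real.rpow r p

/-- `u` is a (positive, viscosity) solution of problem (1):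
`F(x,D²u) + μ u = k(x) u^p` in `Ω`, `u > 0` in `Ω`, `u = 0` on `∂Ω`. -/
def IsSolP1 {N : ℕ} (Ω : Set (Euc N)) (F : Euc N → Matrix (Fin N) (Fin N) ℝ → ℝ)
    (μ : ℝ) (k : Euc N → ℝ) (p : ℝ) (u : Euc N → ℝ) : Prop :=
  ContinuousOn u (closure Ω) ∧ (∀ x ∈ Ω, 0 < u x) ∧
    ViscSubsol Ω (logisticG F μ k p) u ∧ ViscSupersol Ω (logisticG F μ k p) u ∧
    ∀ x ∈ frontier Ω, u x = 0

/-- Condition (K1): `k` is bounded below by a positive constant on `Ω`. -/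
def CondK1 {N : ℕ} (Ω : Set (Euc N)) (k : Euc N → ℝ) : Prop :=
  ∃ k₀ : ℝ, 0 < k₀ ∧ ∀ x ∈ Ω, k₀ ≤ k x

/-- Condition (K2), with the vanishing subdomain `Ω₀` explicit: `Ω₀` is a `C²` bounded domain
compactly contained in `Ω`, `k = 0` on `closure Ω₀`, and `inf_{Ω \ Ω₁} k > 0` for every open
`Ω₁ ⊊ Ω` compactly containing `Ω₀`. -/
def CondK2 {N : ℕ} (Ω Ω₀ : Set (Euc N)) (k : Euc N → ℝ) : Prop :=
  IsC2Domain Ω₀ ∧ closure Ω₀ ⊆ Ω ∧ (∀ x ∈ closure Ω₀, k x = 0) ∧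
    ∀ Ω₁ : Set (Euc N), IsOpen Ω₁ → Ω₁ ⊆ Ω → Ω₁ ≠ Ω → closure Ω₀ ⊆ Ω₁ →
      ∃ c : ℝ, 0 < c ∧ ∀ x ∈ Ω \ Ω₁, c ≤ k x

/-- The sup norm `‖u‖_{L^∞(S)}`. -/
def supNorm {N : ℕ} (S : Set (Euc N)) (u : Euc N → ℝ) : ℝ := sSup (u '' S)

/-- The Pucci maximal operator `𝓜⁺_{lam,Lam}(M) = sup {tr(A M) : lam I ≤ A ≤ Lam I}`. -/
def pucciSup {N : ℕ} (lam Lam : ℝ) (M : Matrix (Fin N) (Fin N) ℝ) : ℝ :=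
  sSup {t : ℝ | ∃ A : Matrix (Fin N) (Fin N) ℝ, A.IsSymm ∧
    MatLE (lam • (1 : Matrix (Fin N) (Fin N) ℝ)) A ∧
    MatLE A (Lam • (1 : Matrix (Fin N) (Fin N) ℝ)) ∧ t = (A * M).trace}

/-- Solution of the blow-up problem on the annulus `Ω \ closure Ω₀`:
`F(x,D²u) + μ u = k(x) u^p` and `u > 0` in `Ω \ closure Ω₀`, `u = 0` on `∂Ω`,
`u(x) → +∞` as `x → ∂Ω₀`. -/
def IsSolBlowUp {N : ℕ} (Ω Ω₀ : Set (Euc N)) (F : Euc N → Matrix (Fin N) (Fin N) ℝ → ℝ)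
    (μ : ℝ) (k : Euc N → ℝ) (p : ℝ) (u : Euc N → ℝ) : Prop :=
  ContinuousOn u (closure Ω \ closure Ω₀) ∧ (∀ x ∈ Ω \ closure Ω₀, 0 < u x) ∧
    ViscSubsol (Ω \ closure Ω₀) (logisticG F μ k p) u ∧
    ViscSupersol (Ω \ closure Ω₀) (logisticG F μ k p) u ∧
    (∀ x ∈ frontier Ω, u x = 0) ∧
    ∀ M : ℝ, ∃ δ : ℝ, 0 < δ ∧
      ∀ x ∈ Ω \ closure Ω₀, Metric.infDist x (frontier Ω₀) < δ → M ≤ u x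

/-- Solution of the Dirichlet problem on the annulus `Ω \ closure Ω₀` with boundary data `0`
on `∂Ω` and `φb` on `∂Ω₀`. -/
def IsSolAnnulus {N : ℕ} (Ω Ω₀ : Set (Euc N)) (F : Euc N → Matrix (Fin N) (Fin N) ℝ → ℝ)
    (μ : ℝ) (k : Euc N → ℝ) (p : ℝ) (φb : Euc N → ℝ) (u : Euc N → ℝ) : Prop :=
  ContinuousOn u (closure (Ω \ closure Ω₀)) ∧ (∀ x ∈ Ω \ closure Ω₀, 0 < u x) ∧
    ViscSubsol (Ω \ closure Ω₀) (logisticG F μ k p) u ∧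
    ViscSupersol (Ω \ closure Ω₀) (logisticG F μ k p) u ∧
    (∀ x ∈ frontier Ω, u x = 0) ∧ ∀ x ∈ frontier Ω₀, u x = φb x

section SemiconvexContact

open Filter Set Metric Module
open scoped ENNReal NNReal Pointwise

theorem abs_sub_le_of_quadratic_increments {ψ : ℝ → ℝ} {a b : ℝ}
    (h : ∀ s ∈ Icc (0 : ℝ) 1, ∀ t ∈ Icc (0 : ℝ) 1, ψ t - ψ s ≤ a * |t - s| + b * (t - s) ^ 2) :
    |ψ 1 - ψ 0| ≤ a := by
  have key : ∀ χ : ℝ → ℝ, (∀ s ∈ Icc (0 : ℝ) 1, ∀ t ∈ Icc (0 : ℝ) 1,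
      χ t - χ s ≤ a * |t - s| + b * (t - s) ^ 2) → χ 1 - χ 0 ≤ a := by
    intro χ hχ
    have step : ∀ m : ℕ, χ 1 - χ 0 ≤ a + b * (1 / ((m : ℝ) + 1)) := by
      intro m
      have hm : (0 : ℝ) < (m : ℝ) + 1 := by positivity
      have ind : ∀ i : ℕ, i ≤ m + 1 →
          χ (i / ((m : ℝ) + 1)) - χ 0 ≤ i * (a / ((m : ℝ) + 1) + b / ((m : ℝ) + 1) ^ 2) := by
        intro i
        induction i with
        | zero => intro _; simp
        | succ i ih =>
          intro hi
          have hi' : ((i : ℝ) + 1) ≤ (m : ℝ) + 1 := by exact_mod_cast hi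
          have h1 := ih (by omega)
          have h2 := hχ (i / ((m : ℝ) + 1))
            ⟨by positivity, by rw [div_le_one hm]; linarith⟩ (((i : ℝ) + 1) / ((m : ℝ) + 1))
            ⟨by positivity, by rw [div_le_one hm]; linarith⟩
          have h3 : ((i : ℝ) + 1) / ((m : ℝ) + 1) - i / ((m : ℝ) + 1) = 1 / ((m : ℝ) + 1) := by
            field_simp; ring
          rw [h3, abs_of_pos (by positivity)] at h2
          push_cast
          have h4 : a * (1 / ((m : ℝ) + 1)) + b * (1 / ((m : ℝ) + 1)) ^ 2
              = a / ((m : ℝ) + 1) + b / ((m : ℝ) + 1) ^ 2 := by field_simp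
          linarith
      have := ind (m + 1) le_rfl
      push_cast at this
      rw [div_self hm.ne'] at this
      refine this.trans (le_of_eq ?_)
      field_simp
    have hlim : Tendsto (fun m : ℕ => a + b * (1 / ((m : ℝ) + 1))) atTop (𝓝 (a + b * 0)) :=
      (tendsto_one_div_add_atTop_nhds_zero_nat.const_mul b).const_add a
    have := ge_of_tendsto' hlim step
    simpa using this
  rw [abs_le]
  constructor
  · have := key (fun t => -ψ t) (fun s hs t ht => by
      have := h t ht s hs
      rw [abs_sub_comm] at this
      have e : (s - t) ^ 2 = (t - s) ^ 2 := by ring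
      rw [e] at this
      linarith)
    linarith
  · exact key ψ h

variable {E : Type*} [NormedAddCommGroup E] [NormedSpace ℝ E]

theorem norm_sub_le_of_contact {W : E → ℝ} {C : ℝ} (hC : 0 ≤ C) {z₁ z₂ : E}
    {p₁ p₂ : E →L[ℝ] ℝ} (hup : ∀ z, W z ≤ W z₁ + p₁ (z - z₁))
    (hlow : W z₁ + p₁ (z₂ - z₁) - C * ‖z₂ - z₁‖ ^ 2 ≤ W z₂)
    (hsub : ∀ z, W z₂ + p₂ (z - z₂) - C * ‖z - z₂‖ ^ 2 ≤ W z) :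
    ‖p₂ - p₁‖ ≤ 2 * C * ‖z₂ - z₁‖ := by
  have key : ∀ e : E, (p₂ - p₁) e ≤ C * ‖e‖ ^ 2 + C * ‖z₂ - z₁‖ ^ 2 := by
    intro e
    have h1 := hup (z₂ + e)
    have h2 := hsub (z₂ + e)
    rw [add_sub_cancel_left] at h2
    have h3 : z₂ + e - z₁ = (z₂ - z₁) + e := by abel
    rw [h3, map_add] at h1
    rw [sub_apply]
    linarith
  set ρ := ‖z₂ - z₁‖ with hρ
  have hρ0 : 0 ≤ ρ := norm_nonneg _
  have bound : ∀ x : E, (p₂ - p₁) x ≤ 2 * C * ρ * ‖x‖ := by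
    intro x
    rcases eq_or_ne x 0 with rfl | hx
    · simp
    have hs : 0 < ‖x‖ := norm_pos_iff.2 hx
    have hr : ∀ r > ρ, (p₂ - p₁) x ≤ 2 * C * r * ‖x‖ := by
      intro r hr
      have hr0 : 0 < r := hρ0.trans_lt hr
      have h := key ((r / ‖x‖) • x)
      rw [map_smul, norm_smul, Real.norm_of_nonneg (by positivity), div_mul_cancel₀ _ hs.ne',
        smul_eq_mul] at h
      have h2 : C * ρ ^ 2 ≤ C * r ^ 2 := by gcongr
      have h3 : r / ‖x‖ * (p₂ - p₁) x ≤ 2 * C * r ^ 2 := by linarith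
      rw [div_mul_eq_mul_div, div_le_iff₀ hs] at h3
      nlinarith
    have hlim : Tendsto (fun r : ℝ => 2 * C * r * ‖x‖) (𝓝[>] ρ) (𝓝 (2 * C * ρ * ‖x‖)) :=
      ((by fun_prop : Continuous fun r : ℝ => 2 * C * r * ‖x‖).tendsto ρ).mono_left
        nhdsWithin_le_nhds
    exact ge_of_tendsto hlim (by filter_upwards [self_mem_nhdsWithin] with r h using hr r h)
  refine ContinuousLinearMap.opNorm_le_bound _ (by positivity) fun x => ?_
  rw [Real.norm_eq_abs, abs_le]
  have h1 := bound x
  have h2 := bound (-x)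
  rw [map_neg, norm_neg] at h2
  constructor <;> linarith

theorem continuous_of_semiconvex {W : E → ℝ} {C M : ℝ} (hC : 0 ≤ C) {P : E → E →L[ℝ] ℝ}
    (hsub : ∀ z z', W z + P z (z' - z) - C * ‖z' - z‖ ^ 2 ≤ W z') (hM : ∀ z, W z ≤ M) :
    Continuous W := by
  rw [continuous_iff_continuousAt]
  intro z₀
  obtain ⟨m, hm⟩ : ∃ m, ∀ z, ‖z - z₀‖ ≤ 1 → m ≤ W z := by
    refine ⟨W z₀ - ‖P z₀‖ - C, fun z hz => ?_⟩
    have h1 := hsub z₀ z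
    have h2 : -(‖P z₀‖) ≤ P z₀ (z - z₀) := by
      have := (P z₀).le_opNorm (z - z₀)
      rw [Real.norm_eq_abs] at this
      have h4 := neg_abs_le (P z₀ (z - z₀))
      nlinarith [norm_nonneg (P z₀)]
    have h3 : C * ‖z - z₀‖ ^ 2 ≤ C := by
      have : ‖z - z₀‖ ^ 2 ≤ 1 := pow_le_one₀ (norm_nonneg _) hz
      nlinarith
    linarith
  set L := |M - m + C| with hL
  have hP : ∀ z e, ‖z - z₀‖ ≤ 1 → ‖e‖ ≤ 1 → P z e ≤ L * ‖e‖ := by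
    intro z e hz he
    rcases eq_or_ne e 0 with rfl | he0
    · simp
    have hs : 0 < ‖e‖ := norm_pos_iff.2 he0
    have h1 := hsub z (z + (1 / ‖e‖) • e)
    rw [add_sub_cancel_left, norm_smul, Real.norm_of_nonneg (by positivity),
      div_mul_cancel₀ _ hs.ne', map_smul, smul_eq_mul] at h1
    have h2 := hM (z + (1 / ‖e‖) • e)
    have h3 := hm z hz
    have h4 : 1 / ‖e‖ * P z e ≤ L := by
      have := le_abs_self (M - m + C)
      linarith
    rw [div_mul_eq_mul_div, div_le_iff₀ hs] at h4
    linarith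
  have est : ∀ z z', ‖z - z₀‖ ≤ 1 → ‖z' - z‖ ≤ 1 → W z - W z' ≤ L * ‖z' - z‖ + C * ‖z' - z‖ ^ 2 := by
    intro z z' hz hz'
    have h1 := hsub z z'
    have h2 := hP z (-(z' - z)) hz (by rwa [norm_neg])
    rw [map_neg, norm_neg] at h2
    linarith
  rw [ContinuousAt, tendsto_iff_norm_sub_tendsto_zero]
  have hlim : Tendsto (fun z => L * ‖z - z₀‖ + C * ‖z - z₀‖ ^ 2) (𝓝 z₀) (𝓝 0) := by
    have : Continuous fun z => L * ‖z - z₀‖ + C * ‖z - z₀‖ ^ 2 := by fun_prop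
    simpa using this.tendsto z₀
  refine squeeze_zero' (Eventually.of_forall fun _ => norm_nonneg _) ?_ hlim
  filter_upwards [closedBall_mem_nhds z₀ one_pos] with z hz
  rw [mem_closedBall, dist_eq_norm] at hz
  rw [Real.norm_eq_abs, abs_le]
  have h1 := est z z₀ hz (by rwa [norm_sub_rev])
  have h2 := est z₀ z (by simp) hz
  rw [norm_sub_rev] at h1
  constructor <;> linarith

theorem exists_linear_contact [FiniteDimensional ℝ E] {W : E → ℝ} {κ : ℝ} (hκ : 0 < κ) {z₀ : E}
    (hW : Continuous W) (hmax : ∀ z, W z ≤ W z₀ - κ * ‖z - z₀‖ ^ 2) (q : E →L[ℝ] ℝ) :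
    ∃ z, (∀ z', W z' ≤ W z + q (z' - z)) ∧ W z₀ ≤ W z + ‖q‖ ^ 2 / κ := by
  have hq : ∀ e, q e ≤ ‖q‖ * ‖e‖ := fun e => (le_abs_self _).trans (q.le_opNorm e)
  have far : ∀ z, ‖q‖ / κ ≤ ‖z - z₀‖ → W z - q z ≤ W z₀ - q z₀ := by
    intro z hz
    have h1 := hmax z
    have h2 := hq (-(z - z₀))
    rw [map_neg, norm_neg, map_sub] at h2
    rw [div_le_iff₀ hκ] at hz
    nlinarith [norm_nonneg (z - z₀)]
  obtain ⟨z, hz⟩ := (by fun_prop : Continuous fun z => W z - q z).exists_forall_ge' z₀ (by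
    have : ∀ᶠ z in cocompact E, z ∉ closedBall z₀ (‖q‖ / κ) :=
      (isCompact_closedBall z₀ (‖q‖ / κ)).compl_mem_cocompact
    filter_upwards [this] with z hz
    rw [mem_closedBall, dist_eq_norm, not_le] at hz
    exact far z hz.le)
  refine ⟨z, fun z' => ?_, ?_⟩
  · have := hz z'
    rw [map_sub]
    linarith
  · have h0 := hz z₀
    have h1 := hmax z
    have h2 := hq (z₀ - z)
    rw [norm_sub_rev, map_sub] at h2
    have h3 : ‖q‖ * ‖z - z₀‖ ≤ ‖q‖ ^ 2 / κ := by
      rw [le_div_iff₀ hκ]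
      have h4 : κ * ‖z - z₀‖ ^ 2 ≤ ‖q‖ * ‖z - z₀‖ := by linarith
      rcases (norm_nonneg (z - z₀)).eq_or_lt with h | h
      · rw [← h]; simp
      · have : κ * ‖z - z₀‖ ≤ ‖q‖ := by
          by_contra hc
          push Not at hc
          nlinarith
        nlinarith [norm_nonneg q]
    linarith

theorem eventually_exists_near_of_density_one [FiniteDimensional ℝ E] [MeasurableSpace E]
    [BorelSpace E] (μ : Measure E) [μ.IsAddHaarMeasure] {K : Set E} {z : E} (hz : z ∈ K)
    (h : Tendsto (fun r => μ (K ∩ closedBall z r) / μ (closedBall z r)) (𝓝[>] 0) (𝓝 1))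
    {ε : ℝ} (hε : 0 < ε) : ∀ᶠ e in 𝓝 (0 : E), ∃ k ∈ K, ‖k - (z + e)‖ ≤ ε * ‖e‖ := by
  obtain ⟨T, hT, hTcover⟩ := (isCompact_sphere (0 : E) 1).elim_nhds_subcover
    (fun e => ball e (ε / 2)) (fun e _ => ball_mem_nhds e (by positivity))
  have hev : ∀ᶠ r in 𝓝[>] (0 : ℝ), ∀ t ∈ T, (K ∩ ({z} + r • ball t (ε / 2))).Nonempty := by
    rw [Filter.eventually_all_finset]
    intro t _
    exact Measure.eventually_nonempty_inter_smul_of_density_one μ K z h _ measurableSet_ball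
      (measure_ball_pos μ t (by positivity)).ne'
  obtain ⟨δ, hδ, hsubset⟩ := mem_nhdsGT_iff_exists_Ioo_subset.1 hev
  filter_upwards [ball_mem_nhds (0 : E) hδ] with e he
  rcases eq_or_ne e 0 with rfl | he0
  · exact ⟨z, hz, by simp⟩
  have hr : 0 < ‖e‖ := norm_pos_iff.2 he0
  have hmem : (1 / ‖e‖) • e ∈ sphere (0 : E) 1 := by
    rw [mem_sphere_zero_iff_norm, norm_smul, Real.norm_of_nonneg (by positivity),
      div_mul_cancel₀ _ hr.ne']
  obtain ⟨t, ht, hte⟩ := mem_iUnion₂.1 (hTcover hmem)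
  obtain ⟨k, hkK, hk⟩ := hsubset ⟨hr, by simpa using he⟩ t ht
  rw [singleton_add, mem_image] at hk
  obtain ⟨y, ⟨b, hb, rfl⟩, rfl⟩ := hk
  refine ⟨_, hkK, ?_⟩
  have e1 : z + (fun x => ‖e‖ • x) b - (z + e) = ‖e‖ • (b - (1 / ‖e‖) • e) := by
    rw [smul_sub, smul_smul, mul_one_div_cancel hr.ne', one_smul]
    simp
  rw [e1, norm_smul, norm_norm, mul_comm]
  gcongr
  rw [mem_ball, dist_eq_norm] at hte hb
  calc ‖b - (1 / ‖e‖) • e‖ = ‖(b - t) - ((1 / ‖e‖) • e - t)‖ := by congr 1; abel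
    _ ≤ ‖b - t‖ + ‖(1 / ‖e‖) • e - t‖ := norm_sub_le _ _
    _ ≤ ε := by linarith

theorem second_order_expansion_of_hasFDerivAt {W : E → ℝ} {C : ℝ} {P : E → E →L[ℝ] ℝ}
    (hsub : ∀ z z', W z + P z (z' - z) - C * ‖z' - z‖ ^ 2 ≤ W z') {z : E}
    {A : E →L[ℝ] E →L[ℝ] ℝ} (hA : HasFDerivAt P A z) {ε : ℝ} (hε : 0 < ε) :
    ∀ᶠ h in 𝓝 (0 : E), |W (z + h) - W z - P z h - 1 / 2 * A h h| ≤ ε * ‖h‖ ^ 2 := by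
  have hlin : ∀ᶠ e in 𝓝 (0 : E), ‖P (z + e) - P z - A e‖ ≤ ε * ‖e‖ := by
    have h1 := (hasFDerivAt_iff_isLittleO_nhds_zero.1 hA).def hε
    exact h1
  obtain ⟨δ, hδ, hball⟩ := Metric.eventually_nhds_iff_ball.1 hlin
  filter_upwards [ball_mem_nhds (0 : E) hδ] with h hh
  have main := abs_sub_le_of_quadratic_increments
    (ψ := fun t => W (z + t • h) - t * P z h - t ^ 2 / 2 * A h h)
    (a := ε * ‖h‖ ^ 2) (b := |A h h| / 2 + C * ‖h‖ ^ 2) (by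
      intro s hs t ht
      have h1 := hsub (z + t • h) (z + s • h)
      have e1 : z + s • h - (z + t • h) = (s - t) • h := by rw [sub_smul]; abel
      rw [e1, map_smul, norm_smul, mul_pow, Real.norm_eq_abs, sq_abs, smul_eq_mul] at h1
      have htb : t • h ∈ ball (0 : E) δ := by
        rw [mem_ball_zero_iff] at hh ⊢
        rw [norm_smul, Real.norm_of_nonneg ht.1]
        nlinarith [norm_nonneg h, ht.2]
      have h2 := hball _ htb
      have h3 : |P (z + t • h) h - P z h - t * A h h| ≤ ε * ‖h‖ ^ 2 := by
        have h4 := (P (z + t • h) - P z - A (t • h)).le_opNorm h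
        rw [sub_apply, sub_apply, map_smul,
          smul_apply, smul_eq_mul, Real.norm_eq_abs] at h4
        refine h4.trans ?_
        rw [norm_smul, Real.norm_of_nonneg ht.1] at h2
        rw [map_smul] at h2
        have h5 : ε * (t * ‖h‖) ≤ ε * ‖h‖ := by
          have : t * ‖h‖ ≤ ‖h‖ := by nlinarith [norm_nonneg h, ht.2]
          gcongr
        nlinarith [norm_nonneg h]
      have h6 : (t - s) * (P (z + t • h) h - P z h - t * A h h) ≤ |t - s| * (ε * ‖h‖ ^ 2) := by
        refine (le_abs_self _).trans ?_
        rw [abs_mul]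
        gcongr
      have h7 : (t - s) ^ 2 * A h h ≤ (t - s) ^ 2 * |A h h| := by
        gcongr
        exact le_abs_self _
      nlinarith)
  simp only [one_smul, one_mul, one_pow, zero_smul, add_zero, zero_mul, sub_zero, ne_eq,
    OfNat.ofNat_ne_zero, not_false_eq_true, zero_pow, zero_div] at main
  convert main using 2
  ring

/-- Combines the lemmas of Jensen and Alexandrov: a semiconvex function with a strict maximum has,
with values arbitrarily close to the maximum, points of contact with affine functions at which it
is twice differentiable in the sense of Peano. -/
theorem exists_second_order_contact [FiniteDimensional ℝ E] {W : E → ℝ} {C κ τ : ℝ} (hC : 0 ≤ C)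
    (hκ : 0 < κ) (hτ : 0 < τ) {z₀ : E}
    (hsub : ∀ z, ∃ p : E →L[ℝ] ℝ, ∀ z', W z + p (z' - z) - C * ‖z' - z‖ ^ 2 ≤ W z')
    (hmax : ∀ z, W z ≤ W z₀ - κ * ‖z - z₀‖ ^ 2) :
    ∃ (z : E) (p : E →L[ℝ] ℝ) (A : E →L[ℝ] E →L[ℝ] ℝ), (∀ h k, A h k = A k h) ∧
      W z₀ ≤ W z + τ ∧ (∀ z', W z' ≤ W z + p (z' - z)) ∧
      (∀ h, -(2 * C) * ‖h‖ ^ 2 ≤ A h h) ∧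
      ∀ ε > 0, ∀ᶠ h in 𝓝 (0 : E), |W (z + h) - W z - p h - 1 / 2 * A h h| ≤ ε * ‖h‖ ^ 2 := by
  choose P hP using hsub
  have hcont : Continuous W := continuous_of_semiconvex hC hP (M := W z₀) fun z => by
    have := hmax z
    have : 0 ≤ κ * ‖z - z₀‖ ^ 2 := by positivity
    linarith
  set K : Set E := {z | W z₀ ≤ W z + τ ∧ ∀ z', W z' ≤ W z + P z (z' - z)} with hK
  have hPK : ∀ z₁ ∈ K, ∀ z₂, ‖P z₂ - P z₁‖ ≤ 2 * C * ‖z₂ - z₁‖ := fun z₁ hz₁ z₂ =>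
    norm_sub_le_of_contact hC hz₁.2 (hP z₁ z₂) (hP z₂)
  have hLip : LipschitzOnWith (Real.toNNReal (2 * C)) P K := by
    refine LipschitzOnWith.of_dist_le_mul fun x _ y hy => ?_
    rw [dist_eq_norm, dist_eq_norm, Real.coe_toNNReal _ (by positivity)]
    exact hPK y hy x
  have himage : ball (0 : E →L[ℝ] ℝ) (Real.sqrt (κ * τ)) ⊆ P '' K := by
    intro q hq
    rw [mem_ball_zero_iff] at hq
    obtain ⟨z, hz1, hz2⟩ := exists_linear_contact hκ hcont hmax q
    have hPz : P z = q := by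
      have := norm_sub_le_of_contact hC hz1 (z₂ := z) (p₂ := P z) (by simp) (hP z)
      rw [sub_self, norm_zero, mul_zero] at this
      exact sub_eq_zero.1 (norm_le_zero_iff.1 this)
    refine ⟨z, ⟨?_, ?_⟩, hPz⟩
    · have h1 : ‖q‖ ^ 2 ≤ κ * τ := by
        rw [← Real.sq_sqrt (by positivity : 0 ≤ κ * τ)]
        gcongr
      have h2 : ‖q‖ ^ 2 / κ ≤ τ := by rw [div_le_iff₀ hκ]; linarith
      linarith
    · rw [hPz]; exact hz1
  borelize E
  set μ : Measure E := Measure.hausdorffMeasure (finrank ℝ E) with hμ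
  have hdim : finrank ℝ (E →L[ℝ] ℝ) = finrank ℝ E := by
    rw [← (LinearMap.toContinuousLinearMap (𝕜 := ℝ) (E := E) (F' := ℝ)).finrank_eq]
    exact Subspace.dual_finrank_eq
  have hKpos : μ K ≠ 0 := by
    intro h0
    have h1 := hLip.hausdorffMeasure_image_le (d := (finrank ℝ E : ℝ)) (by positivity)
    rw [← hμ, h0, mul_zero, ← hdim] at h1
    have h2 : (0 : ℝ≥0∞) < Measure.hausdorffMeasure (finrank ℝ (E →L[ℝ] ℝ) : ℝ)
        (ball (0 : E →L[ℝ] ℝ) (Real.sqrt (κ * τ))) :=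
      measure_ball_pos _ _ (by positivity)
    exact absurd (h2.trans_le ((measure_mono himage).trans h1)) (lt_irrefl _)
  obtain ⟨z, hzK, hdens, hdiff⟩ : ∃ z ∈ K,
      Tendsto (fun r => μ (K ∩ closedBall z r) / μ (closedBall z r)) (𝓝[>] 0) (𝓝 1) ∧
      DifferentiableWithinAt ℝ P K z := by
    by_contra hcon
    push Not at hcon
    have h1 := Measure.measure_inter_eq_zero_of_restrict
      (ae_iff.1 (Besicovitch.ae_tendsto_measure_inter_div μ K))
    have h2 := ae_iff.1 (hLip.ae_differentiableWithinAt_of_mem (μ := μ))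
    refine hKpos (measure_mono_null (fun z hz => ?_) (measure_union_null h1 h2))
    by_cases hd : Tendsto (fun r => μ (K ∩ closedBall z r) / μ (closedBall z r)) (𝓝[>] 0) (𝓝 1)
    · exact Or.inr fun h => hcon z hz hd (h hz)
    · exact Or.inl ⟨hd, hz⟩
  obtain ⟨A, hA⟩ := hdiff
  have hfd : HasFDerivAt P A z := by
    rw [hasFDerivAt_iff_isLittleO_nhds_zero, Asymptotics.isLittleO_iff]
    intro c hc
    set ε : ℝ := min 1 (c / (2 * (1 + 2 * C + ‖A‖))) with hεdef
    have hden : 0 < 2 * (1 + 2 * C + ‖A‖) := by positivity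
    have hε : 0 < ε := lt_min one_pos (by positivity)
    have hε1 : ε ≤ 1 := min_le_left _ _
    have hε2 : ε * (2 * (1 + 2 * C + ‖A‖)) ≤ c := by
      rw [← le_div_iff₀ hden]; exact min_le_right _ _
    have hin : ∀ᶠ k in 𝓝[K] z, ‖P k - P z - A (k - z)‖ ≤ c / 4 * ‖k - z‖ := by
      have := (hasFDerivWithinAt_iff_isLittleO.1 hA).def (show 0 < c / 4 by positivity)
      exact this
    rw [eventually_nhdsWithin_iff, Metric.eventually_nhds_iff_ball] at hin
    obtain ⟨δ, hδ, hin⟩ := hin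
    filter_upwards [eventually_exists_near_of_density_one μ hzK hdens hε,
      ball_mem_nhds (0 : E) (show 0 < δ / 2 by positivity)] with e ⟨k, hkK, hk⟩ he
    rw [mem_ball_zero_iff] at he
    have hkz : ‖k - z‖ ≤ 2 * ‖e‖ := by
      calc ‖k - z‖ = ‖(k - (z + e)) + e‖ := by congr 1; abel
        _ ≤ ‖k - (z + e)‖ + ‖e‖ := norm_add_le _ _
        _ ≤ 2 * ‖e‖ := by nlinarith [norm_nonneg e]
    have h1 := hin k (by rw [mem_ball, dist_eq_norm]; linarith) hkK
    have h2 := hPK k hkK (z + e)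
    rw [norm_sub_rev (z + e) k] at h2
    have h3 : ‖A (k - (z + e))‖ ≤ ‖A‖ * (ε * ‖e‖) := (A.le_opNorm _).trans (by gcongr)
    have e1 : P (z + e) - P z - A e
        = (P (z + e) - P k) + (P k - P z - A (k - z)) + A (k - (z + e)) := by
      rw [map_sub, map_sub, map_add]; abel
    rw [e1]
    calc _ ≤ ‖P (z + e) - P k‖ + ‖P k - P z - A (k - z)‖ + ‖A (k - (z + e))‖ := norm_add₃_le
      _ ≤ 2 * C * (ε * ‖e‖) + c / 4 * (2 * ‖e‖) + ‖A‖ * (ε * ‖e‖) := by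
          gcongr
          · exact h2.trans (by gcongr)
          · exact h1.trans (by gcongr)
      _ = (ε * (2 * (1 + 2 * C + ‖A‖)) / 2 - ε + c / 2) * ‖e‖ := by ring
      _ ≤ c * ‖e‖ := by gcongr; linarith
  have hexp : ∀ ε > 0, ∀ᶠ h in 𝓝 (0 : E),
      |W (z + h) - W z - P z h - 1 / 2 * A h h| ≤ ε * ‖h‖ ^ 2 := fun ε hε =>
    second_order_expansion_of_hasFDerivAt hP hfd hε
  refine ⟨z, P z, (1 / 2 : ℝ) • (A + A.flip), ?_, hzK.1, hzK.2, ?_, ?_⟩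
  · intro h k
    simp [add_comm]
  · intro h
    have hAh : ((1 / 2 : ℝ) • (A + A.flip)) h h = A h h := by simp; ring
    rw [hAh]
    refine le_of_forall_pos_le_add fun ε hε => ?_
    have hs : Tendsto (fun t : ℝ => t • h) (𝓝[>] 0) (𝓝 0) := by
      have : Continuous fun t : ℝ => t • h := by fun_prop
      simpa using (this.tendsto 0).mono_left nhdsWithin_le_nhds
    have hε' : 0 < ε / (2 * (‖h‖ ^ 2 + 1)) := by positivity
    obtain ⟨t, ht, ht0⟩ := ((hs.eventually (hexp _ hε')).and self_mem_nhdsWithin).exists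
    have ht0 : 0 < t := ht0
    have h1 := hP z (z + t • h)
    rw [add_sub_cancel_left] at h1
    have h2 := (abs_le.1 ht).2
    rw [map_smul, map_smul, map_smul, smul_apply, norm_smul, mul_pow, Real.norm_eq_abs,
      sq_abs, smul_eq_mul, smul_eq_mul, smul_eq_mul] at h2
    rw [map_smul, smul_eq_mul, norm_smul, mul_pow, Real.norm_eq_abs, sq_abs] at h1
    have h3 : t ^ 2 * (-(2 * C) * ‖h‖ ^ 2) ≤
        t ^ 2 * (A h h + 2 * (ε / (2 * (‖h‖ ^ 2 + 1)) * ‖h‖ ^ 2)) := by nlinarith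
    have h4 := le_of_mul_le_mul_left h3 (by positivity)
    have h5 : 2 * (ε / (2 * (‖h‖ ^ 2 + 1)) * ‖h‖ ^ 2) ≤ ε := by
      have : 2 * (ε / (2 * (‖h‖ ^ 2 + 1)) * ‖h‖ ^ 2) = ε * (‖h‖ ^ 2 / (‖h‖ ^ 2 + 1)) := by
        field_simp
      rw [this]
      have : ‖h‖ ^ 2 / (‖h‖ ^ 2 + 1) ≤ 1 := by
        rw [div_le_one (by positivity)]; linarith
      nlinarith
    linarith
  · intro ε hε
    filter_upwards [hexp ε hε] with h hh
    have hAh : ((1 / 2 : ℝ) • (A + A.flip)) h h = A h h := by simp; ring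
    rwa [hAh]

end SemiconvexContact

section DoublingVariables

open Filter Set Metric

variable {H : Type*} [NormedAddCommGroup H]

theorem norm_add_sq_le_two_mul (x y : H) : ‖x + y‖ ^ 2 ≤ 2 * ‖x‖ ^ 2 + 2 * ‖y‖ ^ 2 := by
  have h := norm_add_le x y
  have h2 : ‖x + y‖ ^ 2 ≤ (‖x‖ + ‖y‖) ^ 2 := by gcongr
  nlinarith [sq_nonneg (‖x‖ - ‖y‖)]

theorem norm_sub_sq_le_two_mul (x y : H) : ‖x - y‖ ^ 2 ≤ 2 * ‖x‖ ^ 2 + 2 * ‖y‖ ^ 2 := by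
  rw [sub_eq_add_neg, ← norm_neg y]
  exact norm_add_sq_le_two_mul x (-y)

theorem exists_supConvolution {B : Set H} (hB : IsCompact B) (hne : B.Nonempty) {a : H → ℝ}
    (ha : UpperSemicontinuousOn a B) (c : ℝ) :
    ∃ s : H → H, (∀ x, s x ∈ B) ∧
      ∀ x, ∀ ξ ∈ B, a ξ - c * ‖x - ξ‖ ^ 2 ≤ a (s x) - c * ‖x - s x‖ ^ 2 := by
  have : ∀ x, ∃ ξ ∈ B, ∀ ξ' ∈ B, a ξ' - c * ‖x - ξ'‖ ^ 2 ≤ a ξ - c * ‖x - ξ‖ ^ 2 := by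
    intro x
    have hcont : Continuous fun ξ : H => -(c * ‖x - ξ‖ ^ 2) := by fun_prop
    obtain ⟨ξ, hξ, hmax⟩ := (ha.add
      (hcont.continuousOn.upperSemicontinuousOn (s := B))).exists_isMaxOn hne hB
    refine ⟨ξ, hξ, fun ξ' hξ' => ?_⟩
    have := hmax hξ'
    simp only [mem_ofPred_eq] at this
    linarith
  choose s hs1 hs2 using this
  exact ⟨s, hs1, hs2⟩

theorem exists_max_doubling {B : Set H} (hB : IsCompact B) (hne : B.Nonempty) {a b : H → ℝ}
    (ha : UpperSemicontinuousOn a B) (hb : UpperSemicontinuousOn b B) (c : ℝ) :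
    ∃ ξ ∈ B, ∃ η ∈ B, ∀ ξ' ∈ B, ∀ η' ∈ B,
      a ξ' + b η' - c * ‖ξ' - η'‖ ^ 2 ≤ a ξ + b η - c * ‖ξ - η‖ ^ 2 := by
  have h1 : UpperSemicontinuousOn (fun z : H × H => a z.1) (B ×ˢ B) := by
    intro z hz y hy
    have := ha z.1 hz.1 y hy
    exact (tendsto_fst.mono_left (nhdsWithin_prod_eq z.1 z.2 B B).le).eventually this
  have h2 : UpperSemicontinuousOn (fun z : H × H => b z.2) (B ×ˢ B) := by
    intro z hz y hy
    have := hb z.2 hz.2 y hy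
    exact (tendsto_snd.mono_left (nhdsWithin_prod_eq z.1 z.2 B B).le).eventually this
  have hcont : Continuous fun z : H × H => -(c * ‖z.1 - z.2‖ ^ 2) := by fun_prop
  obtain ⟨z, hz, hmax⟩ := ((h1.add h2).add
    (hcont.continuousOn.upperSemicontinuousOn (s := B ×ˢ B))).exists_isMaxOn (hne.prod hne)
      (hB.prod hB)
  refine ⟨z.1, hz.1, z.2, hz.2, fun ξ' hξ' η' hη' => ?_⟩
  have := hmax (mk_mem_prod hξ' hη')
  simp only [mem_ofPred_eq] at this
  linarith

variable [InnerProductSpace ℝ H]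

variable (H) in
/-- The real inner product as a continuous bilinear map. -/
def innerBilin : H →L[ℝ] H →L[ℝ] ℝ :=
  (innerₗ H).mkContinuous₂ 1 fun x y => by
    simpa using norm_inner_le_norm (𝕜 := ℝ) x y

@[simp]
theorem innerBilin_apply (x y : H) : innerBilin H x y = inner ℝ x y := rfl

/-- A form of the theorem on sums (Crandall–Ishii lemma) for the doubled function
`a ξ + b η - α / 2 * ‖ξ - η‖ ^ 2`, at a point where this function is almost maximal. -/
theorem exists_doubling_jets [FiniteDimensional ℝ H] {B : Set H} (hB : IsCompact B)
    (hne : B.Nonempty) {a b : H → ℝ} (ha : UpperSemicontinuousOn a B)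
    (hb : UpperSemicontinuousOn b B) {α κ τ : ℝ} (hα : 0 < α) (hκ : 0 < κ) (hκα : κ ≤ α)
    (hτ : 0 < τ) :
    ∃ ξ ∈ B, ∃ η ∈ B, ∃ (p q : H →L[ℝ] ℝ) (X Z : H →L[ℝ] H →L[ℝ] ℝ),
      (∀ h k, X h k = X k h) ∧ (∀ h k, Z h k = Z k h) ∧
      (∀ ξ' ∈ B, ∀ η' ∈ B,
        a ξ' + b η' - α / 2 * ‖ξ' - η'‖ ^ 2 ≤ a ξ + b η - α / 2 * ‖ξ - η‖ ^ 2 + τ) ∧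
      (∀ ε > 0, ∀ᶠ h in 𝓝 (0 : H), ξ + h ∈ B →
        a (ξ + h) ≤ a ξ + p h + 1 / 2 * X h h + ε * ‖h‖ ^ 2) ∧
      (∀ ε > 0, ∀ᶠ h in 𝓝 (0 : H), η + h ∈ B →
        b (η + h) ≤ b η + q h + 1 / 2 * Z h h + ε * ‖h‖ ^ 2) ∧
      (∀ h k, X h h + Z k k ≤ 2 * α * ‖h - k‖ ^ 2 + 2 * κ * (‖h‖ ^ 2 + ‖k‖ ^ 2)) ∧
      (∀ h, -(20 * α) * ‖h‖ ^ 2 ≤ X h h) ∧ (∀ h, -(20 * α) * ‖h‖ ^ 2 ≤ Z h h) := by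
  obtain ⟨s, hsB, hs⟩ := exists_supConvolution hB hne ha (2 * α)
  obtain ⟨r, hrB, hr⟩ := exists_supConvolution hB hne hb (2 * α)
  obtain ⟨ξ₀, hξ₀, η₀, hη₀, hmax₀⟩ := exists_max_doubling hB hne ha hb (α / 2)
  set U : H → ℝ := fun x => a (s x) - 2 * α * ‖x - s x‖ ^ 2 with hU
  set V : H → ℝ := fun y => b (r y) - 2 * α * ‖y - r y‖ ^ 2 with hV
  set M₀ : ℝ := a ξ₀ + b η₀ - α / 2 * ‖ξ₀ - η₀‖ ^ 2 with hM₀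
  set x₀ : H := ξ₀ - (1 / 4 : ℝ) • (ξ₀ - η₀) with hx₀
  set y₀ : H := η₀ + (1 / 4 : ℝ) • (ξ₀ - η₀) with hy₀
  set W : H × H → ℝ := fun z =>
    U z.1 + V z.2 - α * ‖z.1 - z.2‖ ^ 2 - κ * (‖z.1 - x₀‖ ^ 2 + ‖z.2 - y₀‖ ^ 2) with hW
  have hΦ : ∀ x y, U x + V y - α * ‖x - y‖ ^ 2
      ≤ a (s x) + b (r y) - α / 2 * ‖s x - r y‖ ^ 2 := by
    intro x y
    have e1 : s x - r y = (x - y) + ((y - r y) - (x - s x)) := by abel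
    have h1 := norm_add_sq_le_two_mul (x - y) ((y - r y) - (x - s x))
    have h2 := norm_sub_sq_le_two_mul (y - r y) (x - s x)
    rw [← e1] at h1
    simp only [hU, hV]
    nlinarith
  have hz₀ : M₀ ≤ W (x₀, y₀) := by
    have h1 := hs x₀ ξ₀ hξ₀
    have h2 := hr y₀ η₀ hη₀
    have e1 : x₀ - ξ₀ = -((1 / 4 : ℝ) • (ξ₀ - η₀)) := by rw [hx₀]; abel
    have e2 : y₀ - η₀ = (1 / 4 : ℝ) • (ξ₀ - η₀) := by rw [hy₀]; abel
    have e3 : x₀ - y₀ = (1 / 2 : ℝ) • (ξ₀ - η₀) := by rw [hx₀, hy₀]; module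
    rw [e1, norm_neg, norm_smul, mul_pow] at h1
    rw [e2, norm_smul, mul_pow] at h2
    simp only [hW, hU, hV, hM₀, e3, norm_smul, mul_pow, sub_self, norm_zero]
    norm_num at h1 h2 ⊢
    linarith
  have hmaxW : ∀ z, W z ≤ W (x₀, y₀) - κ * ‖z - (x₀, y₀)‖ ^ 2 := by
    intro z
    have h1 := hΦ z.1 z.2
    have h2 := hmax₀ (s z.1) (hsB _) (r z.2) (hrB _)
    have h3 : ‖z - (x₀, y₀)‖ ^ 2 ≤ ‖z.1 - x₀‖ ^ 2 + ‖z.2 - y₀‖ ^ 2 := by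
      rw [Prod.norm_def]
      rcases max_choice ‖(z - (x₀, y₀)).1‖ ‖(z - (x₀, y₀)).2‖ with h | h <;> rw [h]
      · simp
      · simp
    have h4 : κ * ‖z - (x₀, y₀)‖ ^ 2 ≤ κ * (‖z.1 - x₀‖ ^ 2 + ‖z.2 - y₀‖ ^ 2) := by gcongr
    have h5 : W z = U z.1 + V z.2 - α * ‖z.1 - z.2‖ ^ 2
      - κ * (‖z.1 - x₀‖ ^ 2 + ‖z.2 - y₀‖ ^ 2) := rfl
    linarith
  have hUsub : ∀ x h, U x - 4 * α * inner ℝ (x - s x) h - 2 * α * ‖h‖ ^ 2 ≤ U (x + h) := by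
    intro x h
    have h1 := hs (x + h) (s x) (hsB x)
    have e1 : x + h - s x = (x - s x) + h := by abel
    rw [e1, norm_add_sq_real] at h1
    simp only [hU]
    linarith
  have hVsub : ∀ x h, V x - 4 * α * inner ℝ (x - r x) h - 2 * α * ‖h‖ ^ 2 ≤ V (x + h) := by
    intro x h
    have h1 := hr (x + h) (r x) (hrB x)
    have e1 : x + h - r x = (x - r x) + h := by abel
    rw [e1, norm_add_sq_real] at h1
    simp only [hV]
    linarith
  have hWadd : ∀ x y h k, W (x + h, y + k) = U (x + h) + V (y + k)
      - α * (‖x - y‖ ^ 2 + 2 * inner ℝ (x - y) (h - k) + ‖h - k‖ ^ 2)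
      - κ * ((‖x - x₀‖ ^ 2 + 2 * inner ℝ (x - x₀) h + ‖h‖ ^ 2)
        + (‖y - y₀‖ ^ 2 + 2 * inner ℝ (y - y₀) k + ‖k‖ ^ 2)) := by
    intro x y h k
    simp only [hW]
    rw [← norm_add_sq_real, ← norm_add_sq_real, ← norm_add_sq_real]
    congr 5 <;> abel
  have hW0 : ∀ x y, W (x, y) = U x + V y - α * ‖x - y‖ ^ 2
      - κ * (‖x - x₀‖ ^ 2 + ‖y - y₀‖ ^ 2) := fun _ _ => rfl
  have hsubW : ∀ z, ∃ p : (H × H) →L[ℝ] ℝ, ∀ z',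
      W z + p (z' - z) - (10 * α) * ‖z' - z‖ ^ 2 ≤ W z' := by
    rintro ⟨x, y⟩
    refine ⟨(-(4 * α) • innerSL ℝ (x - s x) - (2 * α) • innerSL ℝ (x - y)
        - (2 * κ) • innerSL ℝ (x - x₀)).comp (ContinuousLinearMap.fst ℝ H H)
      + (-(4 * α) • innerSL ℝ (y - r y) + (2 * α) • innerSL ℝ (x - y)
        - (2 * κ) • innerSL ℝ (y - y₀)).comp (ContinuousLinearMap.snd ℝ H H), ?_⟩
    rintro ⟨x', y'⟩
    obtain ⟨h, rfl⟩ : ∃ h, x' = x + h := ⟨x' - x, by abel⟩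
    obtain ⟨k, rfl⟩ : ∃ k, y' = y + k := ⟨y' - y, by abel⟩
    have e1 : ((x + h, y + k) : H × H) - (x, y) = (h, k) := by simp
    rw [e1, hWadd, hW0]
    have h1 := hUsub x h
    have h2 := hVsub y k
    have h3 := norm_sub_sq_le_two_mul h k
    have h4 : ‖h‖ ^ 2 ≤ ‖(h, k)‖ ^ 2 := by
      gcongr; exact norm_fst_le (h, k)
    have h5 : ‖k‖ ^ 2 ≤ ‖(h, k)‖ ^ 2 := by
      gcongr; exact norm_snd_le (h, k)
    have h6 : α * ‖h - k‖ ^ 2 ≤ α * (4 * ‖(h, k)‖ ^ 2) := by gcongr; linarith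
    have h7 : κ * (‖h‖ ^ 2 + ‖k‖ ^ 2) ≤ α * (2 * ‖(h, k)‖ ^ 2) := by gcongr; linarith
    have h8 : α * ‖h‖ ^ 2 ≤ α * ‖(h, k)‖ ^ 2 := by gcongr
    have h9 : α * ‖k‖ ^ 2 ≤ α * ‖(h, k)‖ ^ 2 := by gcongr
    simp only [add_apply, sub_apply, smul_apply,
      ContinuousLinearMap.comp_apply, ContinuousLinearMap.coe_fst', ContinuousLinearMap.coe_snd',
      innerSL_apply_apply, smul_eq_mul, inner_sub_right]
    linarith
  obtain ⟨⟨x, y⟩, P, A, hAsymm, hclose, hcontact, hAlow, hexp⟩ :=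
    exists_second_order_contact (by positivity : 0 ≤ 10 * α) hκ hτ hsubW hmaxW
  set iX : H →L[ℝ] H × H := ContinuousLinearMap.inl ℝ H H with hiX
  set iY : H →L[ℝ] H × H := ContinuousLinearMap.inr ℝ H H with hiY
  have hX0 : ∀ h, iX h = (h, 0) := fun _ => rfl
  have hY0 : ∀ h, iY h = (0, h) := fun _ => rfl
  have hnX : ∀ h, ‖iX h‖ = ‖h‖ := fun h => by simp [hX0, Prod.norm_def]
  have hnY : ∀ h, ‖iY h‖ = ‖h‖ := fun h => by simp [hY0, Prod.norm_def]
  have expX : ∀ ε > 0, ∀ᶠ h in 𝓝 (0 : H),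
      |W (x + h, y) - W (x, y) - P (iX h) - 1 / 2 * A (iX h) (iX h)| ≤ ε * ‖h‖ ^ 2 := by
    intro ε hε
    have ht : Tendsto iX (𝓝 0) (𝓝 0) := by simpa using iX.continuous.tendsto 0
    filter_upwards [ht.eventually (hexp ε hε)] with h hh
    rw [hnX] at hh
    simpa [hX0] using hh
  have expY : ∀ ε > 0, ∀ᶠ h in 𝓝 (0 : H),
      |W (x, y + h) - W (x, y) - P (iY h) - 1 / 2 * A (iY h) (iY h)| ≤ ε * ‖h‖ ^ 2 := by
    intro ε hε
    have ht : Tendsto iY (𝓝 0) (𝓝 0) := by simpa using iY.continuous.tendsto 0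
    filter_upwards [ht.eventually (hexp ε hε)] with h hh
    rw [hnY] at hh
    simpa [hY0] using hh
  have hWX : ∀ h, W (x + h, y) = U (x + h) + V y
      - α * (‖x - y‖ ^ 2 + 2 * inner ℝ (x - y) h + ‖h‖ ^ 2)
      - κ * ((‖x - x₀‖ ^ 2 + 2 * inner ℝ (x - x₀) h + ‖h‖ ^ 2) + ‖y - y₀‖ ^ 2) := fun h => by
    have := hWadd x y h 0
    simpa using this
  have hWY : ∀ h, W (x, y + h) = U x + V (y + h)
      - α * (‖x - y‖ ^ 2 - 2 * inner ℝ (x - y) h + ‖h‖ ^ 2)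
      - κ * (‖x - x₀‖ ^ 2 + (‖y - y₀‖ ^ 2 + 2 * inner ℝ (y - y₀) h + ‖h‖ ^ 2)) := fun h => by
    have := hWadd x y 0 h
    simpa [← sub_eq_add_neg] using this
  refine ⟨s x, hsB x, r y, hrB y,
    P.comp iX + (2 * α) • innerSL ℝ (x - y) + (2 * κ) • innerSL ℝ (x - x₀),
    P.comp iY - (2 * α) • innerSL ℝ (x - y) + (2 * κ) • innerSL ℝ (y - y₀),
    A.bilinearComp iX iX + (2 * (α + κ)) • innerBilin H,
    A.bilinearComp iY iY + (2 * (α + κ)) • innerBilin H, ?_, ?_, ?_, ?_, ?_, ?_, ?_, ?_⟩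
  · intro h k
    simp [hAsymm (iX h) (iX k), real_inner_comm h k]
  · intro h k
    simp [hAsymm (iY h) (iY k), real_inner_comm h k]
  · intro ξ' hξ' η' hη'
    have h1 := hmax₀ ξ' hξ' η' hη'
    have h2 := hΦ x y
    have h3 : 0 ≤ κ * (‖x - x₀‖ ^ 2 + ‖y - y₀‖ ^ 2) := by positivity
    have h4 := hW0 x y
    linarith
  · intro ε hε
    filter_upwards [expX ε hε] with h hh hmem
    have h1 := (abs_le.1 hh).2
    have h2 := hs (x + h) (s x + h) hmem
    have e1 : x + h - (s x + h) = x - s x := by abel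
    rw [e1] at h2
    rw [hWX, hW0] at h1
    have h3 : U (x + h) = a (s (x + h)) - 2 * α * ‖x + h - s (x + h)‖ ^ 2 := rfl
    have h4 : U x = a (s x) - 2 * α * ‖x - s x‖ ^ 2 := rfl
    simp only [add_apply, smul_apply, ContinuousLinearMap.comp_apply, innerSL_apply_apply,
      innerBilin_apply, smul_eq_mul, ContinuousLinearMap.bilinearComp_apply, real_inner_self_eq_norm_sq]
    linarith
  · intro ε hε
    filter_upwards [expY ε hε] with h hh hmem
    have h1 := (abs_le.1 hh).2
    have h2 := hr (y + h) (r y + h) hmem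
    have e1 : y + h - (r y + h) = y - r y := by abel
    rw [e1] at h2
    rw [hWY, hW0] at h1
    have h3 : V (y + h) = b (r (y + h)) - 2 * α * ‖y + h - r (y + h)‖ ^ 2 := rfl
    have h4 : V y = b (r y) - 2 * α * ‖y - r y‖ ^ 2 := rfl
    simp only [add_apply, sub_apply, smul_apply, ContinuousLinearMap.comp_apply,
      innerSL_apply_apply, innerBilin_apply, smul_eq_mul, ContinuousLinearMap.bilinearComp_apply,
      real_inner_self_eq_norm_sq]
    linarith
  · intro h k
    have main : A (iX h) (iX h) + A (iY k) (iY k) + 4 * α * inner ℝ h k ≤ 0 := by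
      refine le_of_forall_pos_le_add fun δ hδ => ?_
      set ε : ℝ := δ / (2 * (‖h‖ ^ 2 + ‖k‖ ^ 2 + 1)) with hε
      have hε0 : 0 < ε := by positivity
      have hεδ : 2 * ε * (‖h‖ ^ 2 + ‖k‖ ^ 2) ≤ δ := by
        have : 2 * ε * (‖h‖ ^ 2 + ‖k‖ ^ 2 + 1) = δ := by rw [hε]; field_simp
        nlinarith
      have ht : ∀ e : H, Tendsto (fun t : ℝ => t • e) (𝓝[>] 0) (𝓝 0) := fun e => by
        have : Continuous fun t : ℝ => t • e := by fun_prop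
        simpa using (this.tendsto 0).mono_left nhdsWithin_le_nhds
      obtain ⟨t, ⟨ht1, ht2⟩, ht0⟩ := ((((ht h).eventually (expX ε hε0)).and
        ((ht k).eventually (expY ε hε0))).and self_mem_nhdsWithin).exists
      have ht0 : 0 < t := ht0
      have h1 := (abs_le.1 ht1).1
      have h2 := (abs_le.1 ht2).1
      have h3 := hcontact (x + t • h, y + t • k)
      have e1 : ((x + t • h, y + t • k) : H × H) - (x, y) = iX (t • h) + iY (t • k) := by
        simp [hX0, hY0]
      rw [e1, map_add, hWadd, hW0] at h3
      rw [hWX, hW0] at h1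
      rw [hWY, hW0] at h2
      have eA : A (iX (t • h)) (iX (t • h)) = t ^ 2 * A (iX h) (iX h) := by
        simp only [map_smul, smul_apply, smul_eq_mul]; ring
      have eB : A (iY (t • k)) (iY (t • k)) = t ^ 2 * A (iY k) (iY k) := by
        simp only [map_smul, smul_apply, smul_eq_mul]; ring
      have en : ∀ e : H, ‖t • e‖ ^ 2 = t ^ 2 * ‖e‖ ^ 2 := fun e => by
        rw [norm_smul, mul_pow, Real.norm_eq_abs, sq_abs]
      have ei : (inner ℝ (t • h) (t • k) : ℝ) = t ^ 2 * inner ℝ h k := by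
        rw [real_inner_smul_left, real_inner_smul_right]; ring
      rw [inner_sub_right, norm_sub_sq_real (t • h), ei, en, en] at h3
      rw [eA, en] at h1
      rw [eB, en] at h2
      have h4 : t ^ 2 * (A (iX h) (iX h) + A (iY k) (iY k) + 4 * α * inner ℝ h k)
          ≤ t ^ 2 * (2 * ε * (‖h‖ ^ 2 + ‖k‖ ^ 2)) := by linarith
      have h5 := le_of_mul_le_mul_left h4 (by positivity)
      linarith
    simp only [add_apply, smul_apply, ContinuousLinearMap.bilinearComp_apply, smul_eq_mul,
      innerBilin_apply, real_inner_self_eq_norm_sq]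
    rw [norm_sub_sq_real]
    linarith
  · intro h
    have h1 := hAlow (iX h)
    rw [hnX] at h1
    have h2 : 0 ≤ 2 * (α + κ) * ‖h‖ ^ 2 := by positivity
    simp only [add_apply, smul_apply, ContinuousLinearMap.bilinearComp_apply, smul_eq_mul,
      innerBilin_apply, real_inner_self_eq_norm_sq]
    linarith
  · intro h
    have h1 := hAlow (iY h)
    rw [hnY] at h1
    have h2 : 0 ≤ 2 * (α + κ) * ‖h‖ ^ 2 := by positivity
    simp only [add_apply, smul_apply, ContinuousLinearMap.bilinearComp_apply, smul_eq_mul,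
      innerBilin_apply, real_inner_self_eq_norm_sq]
    linarith

end DoublingVariables

section BilinearMatrix

open Filter

variable {N : ℕ}

/-- Continuous bilinear forms on Euclidean space. -/
abbrev EucBilin (N : ℕ) := Euc N →L[ℝ] Euc N →L[ℝ] ℝ

/-- The matrix of a bilinear form in the standard basis. -/
def bilinMatrix (B : EucBilin N) : Matrix (Fin N) (Fin N) ℝ :=
  Matrix.of fun i j => B (EuclideanSpace.single i 1) (EuclideanSpace.single j 1)

theorem bilinMatrix_apply (B : EucBilin N) (i j : Fin N) :
    bilinMatrix B i j = B (EuclideanSpace.single i 1) (EuclideanSpace.single j 1) := rfl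

theorem hessianMatrix_eq_bilinMatrix (φ : Euc N → ℝ) (x : Euc N) :
    hessianMatrix φ x = bilinMatrix (fderiv ℝ (fderiv ℝ φ) x) := by
  ext i j
  simp [hessianMatrix, bilinMatrix_apply, iteratedFDeriv_two_apply]

theorem bilinMatrix_add (B C : EucBilin N) : bilinMatrix (B + C) = bilinMatrix B + bilinMatrix C := by
  ext i j
  simp [bilinMatrix_apply]

theorem bilinMatrix_sub (B C : EucBilin N) : bilinMatrix (B - C) = bilinMatrix B - bilinMatrix C := by
  ext i j
  simp [bilinMatrix_apply]

theorem bilinMatrix_neg (B : EucBilin N) : bilinMatrix (-B) = -bilinMatrix B := by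
  ext i j
  simp [bilinMatrix_apply]

theorem bilinMatrix_smul (c : ℝ) (B : EucBilin N) : bilinMatrix (c • B) = c • bilinMatrix B := by
  ext i j
  simp [bilinMatrix_apply]

theorem bilinMatrix_innerBilin : bilinMatrix (innerBilin (Euc N)) = 1 := by
  ext i j
  simp [bilinMatrix_apply, Matrix.one_apply, EuclideanSpace.inner_single_left]

theorem bilinMatrix_isSymm {B : EucBilin N} (hB : ∀ h k, B h k = B k h) :
    (bilinMatrix B).IsSymm := by
  ext i j
  simp [bilinMatrix_apply, hB (EuclideanSpace.single i 1)]

theorem dotProduct_bilinMatrix_mulVec (B : EucBilin N) (x y : Fin N → ℝ) :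
    x ⬝ᵥ (bilinMatrix B *ᵥ y) = B (WithLp.toLp 2 x) (WithLp.toLp 2 y) := by
  have hrep : ∀ z : Fin N → ℝ,
      (WithLp.toLp 2 z : Euc N) = ∑ i, z i • EuclideanSpace.single i (1 : ℝ) := by
    intro z
    ext j
    simp [Finset.sum_apply, Pi.single_apply]
  rw [hrep x, hrep y]
  simp only [map_sum, map_smul, sum_apply, smul_apply, smul_eq_mul,
    dotProduct, Matrix.mulVec, bilinMatrix_apply, Finset.mul_sum]
  rw [Finset.sum_comm]
  refine Finset.sum_congr rfl fun i _ => Finset.sum_congr rfl fun j _ => by ring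

theorem bilinMatrix_posSemidef {B : EucBilin N} (hB : ∀ h k, B h k = B k h)
    (hpos : ∀ h, 0 ≤ B h h) : (bilinMatrix B).PosSemidef := by
  refine Matrix.PosSemidef.of_dotProduct_mulVec_nonneg ?_ fun x => ?_
  · exact Matrix.isHermitian_iff_isSymm.2 (bilinMatrix_isSymm hB)
  · simpa [dotProduct_bilinMatrix_mulVec] using hpos _

theorem innerBilin_symm (h k : Euc N) : innerBilin (Euc N) h k = innerBilin (Euc N) k h := by
  simp [real_inner_comm]

theorem fderiv_fderiv_symm {φ : Euc N → ℝ} (hφ : ContDiff ℝ 2 φ) (x h k : Euc N) :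
    fderiv ℝ (fderiv ℝ φ) x h k = fderiv ℝ (fderiv ℝ φ) x k h :=
  (hφ.contDiffAt.isSymmSndFDerivAt (by simp)).eq h k

theorem sum_elim_dotProduct_fromBlocks_mulVec (B C D E : EucBilin N) (x y : Fin N → ℝ) :
    Sum.elim x y ⬝ᵥ (Matrix.fromBlocks (bilinMatrix B) (bilinMatrix C) (bilinMatrix D)
      (bilinMatrix E) *ᵥ Sum.elim x y)
    = B (WithLp.toLp 2 x) (WithLp.toLp 2 x) + C (WithLp.toLp 2 x) (WithLp.toLp 2 y)
      + D (WithLp.toLp 2 y) (WithLp.toLp 2 x) + E (WithLp.toLp 2 y) (WithLp.toLp 2 y) := by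
  simp only [Matrix.fromBlocks_mulVec, Sum.elim_comp_inl, Sum.elim_comp_inr,
    sumElim_dotProduct_sumElim, dotProduct_add, dotProduct_bilinMatrix_mulVec]
  ring

theorem fromBlocks_bilinMatrix_posSemidef {B C E : EucBilin N} (hB : ∀ h k, B h k = B k h)
    (hC : ∀ h k, C h k = C k h) (hE : ∀ h k, E h k = E k h)
    (hpos : ∀ h k, 0 ≤ B h h + 2 * C h k + E k k) :
    (Matrix.fromBlocks (bilinMatrix B) (bilinMatrix C) (bilinMatrix C)
      (bilinMatrix E)).PosSemidef := by
  refine Matrix.PosSemidef.of_dotProduct_mulVec_nonneg ?_ fun x => ?_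
  · have h1 : (bilinMatrix B)ᵀ = bilinMatrix B := bilinMatrix_isSymm hB
    have h2 : (bilinMatrix C)ᵀ = bilinMatrix C := bilinMatrix_isSymm hC
    have h3 : (bilinMatrix E)ᵀ = bilinMatrix E := bilinMatrix_isSymm hE
    rw [Matrix.IsHermitian, Matrix.conjTranspose_eq_transpose_of_trivial,
      Matrix.fromBlocks_transpose, h1, h2, h3]
  · rw [star_trivial, ← Sum.elim_comp_inl_inr x, sum_elim_dotProduct_fromBlocks_mulVec,
      hC (WithLp.toLp 2 (x ∘ Sum.inr))]
    linarith [hpos (WithLp.toLp 2 (x ∘ Sum.inl)) (WithLp.toLp 2 (x ∘ Sum.inr))]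

/-- Condition (F3) in terms of bilinear forms. -/
theorem IsF3.exists_modulus {Ω : Set (Euc N)} {F : Euc N → Matrix (Fin N) (Fin N) ℝ → ℝ}
    (hF3 : IsF3 Ω F) : ∃ ω : ℝ → ℝ, ω 0 = 0 ∧ ContinuousAt ω 0 ∧
      ∀ α : ℝ, 0 < α → ∀ x ∈ Ω, ∀ y ∈ Ω, ∀ X Z : EucBilin N, (∀ h k, X h k = X k h) →
        (∀ h k, Z h k = Z k h) → (∀ h k, X h h + Z k k ≤ 3 * α * ‖h - k‖ ^ 2) →
        (∀ h, -(3 * α) * ‖h‖ ^ 2 ≤ X h h) → (∀ h, -(3 * α) * ‖h‖ ^ 2 ≤ Z h h) →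
        F x (bilinMatrix X) - F y (bilinMatrix (-Z)) ≤ ω (α * ‖x - y‖ ^ 2 + ‖x - y‖) := by
  obtain ⟨ω, -, h0, hcont, -, hω⟩ := hF3
  refine ⟨ω, h0, hcont, fun α hα x hx y hy X Z hX hZ hle hXl hZl => ?_⟩
  have h00 : (0 : Matrix (Fin N) (Fin N) ℝ) = bilinMatrix 0 := by
    ext i j; simp [bilinMatrix_apply]
  refine hω α hα x hx y hy _ _ (bilinMatrix_isSymm hX)
    (bilinMatrix_isSymm fun h k => by simp [hZ h k]) ?_ ?_
  · rw [MatLE, ← Matrix.fromBlocks_one, Matrix.fromBlocks_smul, sub_eq_add_neg,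
      Matrix.fromBlocks_neg, Matrix.fromBlocks_add]
    have e1 : bilinMatrix X + -(-(3 * α) • (1 : Matrix (Fin N) (Fin N) ℝ))
        = bilinMatrix (X + (3 * α) • innerBilin (Euc N)) := by
      rw [bilinMatrix_add, bilinMatrix_smul, bilinMatrix_innerBilin, neg_smul, neg_neg]
    have e2 : -bilinMatrix (-Z) + -(-(3 * α) • (1 : Matrix (Fin N) (Fin N) ℝ))
        = bilinMatrix (Z + (3 * α) • innerBilin (Euc N)) := by
      rw [bilinMatrix_add, bilinMatrix_smul, bilinMatrix_innerBilin, neg_smul, neg_neg,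
        bilinMatrix_neg, neg_neg]
    rw [e1, e2, smul_zero, neg_zero, add_zero, h00]
    refine fromBlocks_bilinMatrix_posSemidef (fun h k => ?_) (fun h k => rfl) (fun h k => ?_)
      fun h k => ?_
    · simp [hX h k, real_inner_comm]
    · simp [hZ h k, real_inner_comm]
    · have := hXl h
      have := hZl k
      simp only [add_apply, smul_apply, innerBilin_apply, real_inner_self_eq_norm_sq,
        smul_eq_mul, zero_apply]
      linarith
  · rw [MatLE, Matrix.fromBlocks_smul, sub_eq_add_neg, Matrix.fromBlocks_neg,
      Matrix.fromBlocks_add]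
    have e1 : (3 * α) • (1 : Matrix (Fin N) (Fin N) ℝ) + -bilinMatrix X
        = bilinMatrix ((3 * α) • innerBilin (Euc N) - X) := by
      rw [bilinMatrix_sub, bilinMatrix_smul, bilinMatrix_innerBilin, sub_eq_add_neg]
    have e2 : (3 * α) • (1 : Matrix (Fin N) (Fin N) ℝ) + -(-bilinMatrix (-Z))
        = bilinMatrix ((3 * α) • innerBilin (Euc N) - Z) := by
      rw [bilinMatrix_sub, bilinMatrix_smul, bilinMatrix_innerBilin, sub_eq_add_neg,
        bilinMatrix_neg, neg_neg]
    have e3 : (3 * α) • (-1 : Matrix (Fin N) (Fin N) ℝ) + -0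
        = bilinMatrix (-((3 * α) • innerBilin (Euc N))) := by
      rw [bilinMatrix_neg, bilinMatrix_smul, bilinMatrix_innerBilin, neg_zero, add_zero, smul_neg]
    rw [e1, e2, e3]
    refine fromBlocks_bilinMatrix_posSemidef (fun h k => ?_) (fun h k => ?_) (fun h k => ?_)
      fun h k => ?_
    · simp [hX h k, real_inner_comm]
    · simp [real_inner_comm]
    · simp [hZ h k, real_inner_comm]
    · have := hle h k
      rw [norm_sub_sq_real] at this
      simp only [neg_apply, sub_apply, smul_apply, innerBilin_apply, real_inner_self_eq_norm_sq,
        smul_eq_mul]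
      linarith

variable {Ω : Set (Euc N)} {F : Euc N → Matrix (Fin N) (Fin N) ℝ → ℝ} {lam Lam : ℝ}

theorem IsF1.mono (hF1 : IsF1 Ω F lam Lam) {x : Euc N} (hx : x ∈ Ω) {X Y : EucBilin N}
    (hX : ∀ h k, X h k = X k h) (hY : ∀ h k, Y h k = Y k h) (hXY : ∀ h, X h h ≤ Y h h) :
    F x (bilinMatrix X) ≤ F x (bilinMatrix Y) := by
  have hP : (bilinMatrix (Y - X)).PosSemidef := bilinMatrix_posSemidef
    (fun h k => by simp [hX h k, hY h k]) fun h => by simpa using hXY h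
  have h1 := (hF1.2.2 x hx _ _ (bilinMatrix_isSymm hX) hP).1
  have e1 : X + (Y - X) = Y := by abel
  rw [← bilinMatrix_add, e1] at h1
  have h2 : 0 ≤ lam * (bilinMatrix (Y - X)).trace := mul_nonneg hF1.1.le hP.trace_nonneg
  linarith

theorem IsF1.le_add_mul (hF1 : IsF1 Ω F lam Lam) {x : Euc N} (hx : x ∈ Ω) {X Y : EucBilin N}
    (hX : ∀ h k, X h k = X k h) (hY : ∀ h k, Y h k = Y k h) {c : ℝ} (hc : 0 ≤ c)
    (hXY : ∀ h, Y h h ≤ X h h + c * ‖h‖ ^ 2) :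
    F x (bilinMatrix Y) ≤ F x (bilinMatrix X) + c * (Lam * N) := by
  have hJ : ∀ h k, (c • innerBilin (Euc N)) h k = (c • innerBilin (Euc N)) k h := fun h k => by
    simp [real_inner_comm]
  have hXJ : ∀ h k, (X + c • innerBilin (Euc N)) h k = (X + c • innerBilin (Euc N)) k h :=
    fun h k => by simp [hX h k, real_inner_comm]
  have h1 : F x (bilinMatrix Y) ≤ F x (bilinMatrix (X + c • innerBilin (Euc N))) :=
    hF1.mono hx hY hXJ fun h => by simpa using hXY h
  have hP : (bilinMatrix (c • innerBilin (Euc N))).PosSemidef :=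
    bilinMatrix_posSemidef hJ fun h => by simp; positivity
  have h2 := (hF1.2.2 x hx _ _ (bilinMatrix_isSymm hX) hP).2
  rw [← bilinMatrix_add] at h2
  have h3 : (bilinMatrix (c • innerBilin (Euc N))).trace = c * N := by
    rw [bilinMatrix_smul, bilinMatrix_innerBilin, Matrix.trace_smul, Matrix.trace_one]
    simp
  rw [h3] at h2
  linarith

/-- The symmetric matrix with eigenvalues `d` in the orthonormal basis given by `U`. -/
def conjDiag (U : Matrix.unitaryGroup (Fin N) ℝ) (d : Fin N → ℝ) : Matrix (Fin N) (Fin N) ℝ :=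
  U * Matrix.diagonal d * star (U : Matrix (Fin N) (Fin N) ℝ)

theorem conjDiag_sub (U : Matrix.unitaryGroup (Fin N) ℝ) (d e : Fin N → ℝ) :
    conjDiag U (d - e) = conjDiag U d - conjDiag U e := by
  rw [conjDiag, conjDiag, conjDiag, ← sub_mul, ← mul_sub, Matrix.diagonal_sub]
  rfl

theorem conjDiag_const (U : Matrix.unitaryGroup (Fin N) ℝ) (c : ℝ) :
    conjDiag U (fun _ => c) = c • 1 := by
  have h : Matrix.diagonal (fun _ : Fin N => c) = c • (1 : Matrix (Fin N) (Fin N) ℝ) := by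
    rw [Matrix.smul_one_eq_diagonal]
  rw [conjDiag, h, mul_smul_comm, mul_one, smul_mul_assoc, Unitary.mul_star_self_of_mem U.2]

theorem conjDiag_posSemidef (U : Matrix.unitaryGroup (Fin N) ℝ) {d : Fin N → ℝ} (hd : 0 ≤ d) :
    (conjDiag U d).PosSemidef := by
  have := (Matrix.PosSemidef.diagonal hd).mul_mul_conjTranspose_same
    (U : Matrix (Fin N) (Fin N) ℝ)
  rwa [← Matrix.star_eq_conjTranspose] at this

theorem trace_mul_conjDiag (U : Matrix.unitaryGroup (Fin N) ℝ) (A : Matrix (Fin N) (Fin N) ℝ)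
    (e : Fin N → ℝ) : (A * conjDiag U e).trace
      = ∑ i, (star (U : Matrix (Fin N) (Fin N) ℝ) * A * U) i i * e i := by
  rw [conjDiag, ← mul_assoc, Matrix.trace_mul_comm, ← mul_assoc, ← mul_assoc, Matrix.trace]
  simp [Matrix.mul_diagonal]

theorem star_mul_conjDiag_mul (U : Matrix.unitaryGroup (Fin N) ℝ) (d : Fin N → ℝ) :
    star (U : Matrix (Fin N) (Fin N) ℝ) * conjDiag U d * U = Matrix.diagonal d := by
  have h : star (U : Matrix (Fin N) (Fin N) ℝ) * U = 1 := Matrix.UnitaryGroup.star_mul_self U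
  rw [conjDiag, ← mul_assoc, ← mul_assoc, h, one_mul, mul_assoc, h, mul_one]

theorem trace_conjDiag (U : Matrix.unitaryGroup (Fin N) ℝ) (e : Fin N → ℝ) :
    (conjDiag U e).trace = ∑ i, e i := by
  have h := trace_mul_conjDiag U 1 e
  have h1 : star (U : Matrix (Fin N) (Fin N) ℝ) * U = 1 := Matrix.UnitaryGroup.star_mul_self U
  rw [one_mul, mul_one, h1] at h
  simpa using h

theorem sum_mul_le_pucciSup (U : Matrix.unitaryGroup (Fin N) ℝ) {d : Fin N → ℝ}
    (hd : ∀ i, lam ≤ d i) (hd' : ∀ i, d i ≤ Lam) (e : Fin N → ℝ) :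
    ∑ i, d i * e i ≤ pucciSup lam Lam (conjDiag U e) := by
  refine le_csSup ⟨∑ i, max (lam * e i) (Lam * e i), ?_⟩
    ⟨conjDiag U d, ?_, ?_, ?_, ?_⟩
  · rintro t ⟨A, -, hl, hL, rfl⟩
    have h1 : star (U : Matrix (Fin N) (Fin N) ℝ) * U = 1 := Matrix.UnitaryGroup.star_mul_self U
    rw [trace_mul_conjDiag]
    refine Finset.sum_le_sum fun i _ => ?_
    have h2 := (hl.conjTranspose_mul_mul_same (U : Matrix (Fin N) (Fin N) ℝ)).diag_nonneg (i := i)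
    have h3 := (hL.conjTranspose_mul_mul_same (U : Matrix (Fin N) (Fin N) ℝ)).diag_nonneg (i := i)
    rw [← Matrix.star_eq_conjTranspose, mul_sub, sub_mul, mul_smul_comm, smul_mul_assoc, mul_one,
      h1] at h2 h3
    simp only [Matrix.sub_apply, Matrix.smul_apply, Matrix.one_apply_eq, smul_eq_mul, mul_one,
      sub_nonneg] at h2 h3
    rcases le_total 0 (e i) with h | h
    · exact (mul_le_mul_of_nonneg_right h3 h).trans (le_max_right _ _)
    · exact (mul_le_mul_of_nonpos_right h2 h).trans (le_max_left _ _)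
  · exact Matrix.isHermitian_iff_isSymm.1
      (Matrix.isHermitian_mul_mul_conjTranspose _ (Matrix.isHermitian_diagonal d))
  · rw [MatLE, ← conjDiag_const U, ← conjDiag_sub]
    exact conjDiag_posSemidef U fun i => by simpa using hd i
  · rw [MatLE, ← conjDiag_const U, ← conjDiag_sub]
    exact conjDiag_posSemidef U fun i => by simpa using hd' i
  · rw [trace_mul_conjDiag, star_mul_conjDiag_mul]
    simp

theorem IsF1.le_add_pucciSup (hF1 : IsF1 Ω F lam Lam) {x : Euc N} (hx : x ∈ Ω)
    {X M : Matrix (Fin N) (Fin N) ℝ} (hX : X.IsSymm) (hM : M.IsSymm) :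
    F x (X + M) ≤ F x X + pucciSup lam Lam M := by
  have hM' : M.IsHermitian := Matrix.isHermitian_iff_isSymm.2 hM
  obtain ⟨U, e, rfl⟩ : ∃ U e, M = conjDiag U e :=
    ⟨hM'.eigenvectorUnitary, hM'.eigenvalues, by
      conv_lhs => rw [hM'.spectral_theorem, Unitary.conjStarAlgAut_apply]
      rfl⟩
  have hp := conjDiag_posSemidef U (d := fun i => max (e i) 0) fun i => le_max_right _ _
  have hn := conjDiag_posSemidef U (d := fun i => max (-e i) 0) fun i => le_max_right _ _
  have he : e = (fun i => max (e i) 0) - fun i => max (-e i) 0 := by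
    ext i
    exact (max_zero_sub_max_neg_zero_eq_self (e i)).symm
  have hsymm : (X - conjDiag U fun i => max (-e i) 0).IsSymm :=
    hX.sub (Matrix.isHermitian_iff_isSymm.1 hn.isHermitian)
  have h1 := (hF1.2.2 x hx _ _ hsymm hp).2
  have h2 := (hF1.2.2 x hx _ _ hsymm hn).1
  have e1 : (X - conjDiag U fun i => max (-e i) 0) + (conjDiag U fun i => max (e i) 0)
      = X + conjDiag U e := by
    conv_rhs => rw [he, conjDiag_sub]
    abel
  rw [e1, trace_conjDiag] at h1
  rw [sub_add_cancel, trace_conjDiag] at h2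
  have h3 := sum_mul_le_pucciSup (lam := lam) (Lam := Lam) U
    (d := fun i => if 0 ≤ e i then Lam else lam)
    (fun i => by split_ifs <;> linarith [hF1.2.1]) (fun i => by split_ifs <;> linarith [hF1.2.1]) e
  have h4 : ∑ i, (if 0 ≤ e i then Lam else lam) * e i
      = Lam * ∑ i, max (e i) 0 - lam * ∑ i, max (-e i) 0 := by
    rw [Finset.mul_sum, Finset.mul_sum, ← Finset.sum_sub_distrib]
    refine Finset.sum_congr rfl fun i _ => ?_
    split_ifs with h
    · rw [max_eq_left h, max_eq_right (by linarith)]; ring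
    · rw [max_eq_right (by linarith), max_eq_left (by linarith)]; ring
  rw [h4] at h3
  linarith

/-- The function `φ` plus a quadratic polynomial centred at `ξ`. -/
def addQuadratic (φ : Euc N → ℝ) (ξ : Euc N) (c : ℝ) (ℓ : Euc N →L[ℝ] ℝ) (B : EucBilin N)
    (x : Euc N) : ℝ :=
  φ x + (c + ℓ (x - ξ) + 1 / 2 * B (x - ξ) (x - ξ))

theorem contDiff_addQuadratic {φ : Euc N → ℝ} (hφ : ContDiff ℝ 2 φ) (ξ : Euc N) (c : ℝ)
    (ℓ : Euc N →L[ℝ] ℝ) (B : EucBilin N) : ContDiff ℝ 2 (addQuadratic φ ξ c ℓ B) := by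
  unfold addQuadratic
  fun_prop

theorem hessianMatrix_addQuadratic {φ : Euc N → ℝ} (hφ : ContDiff ℝ 2 φ) (ξ : Euc N) (c : ℝ)
    (ℓ : Euc N →L[ℝ] ℝ) {B : EucBilin N} (hB : ∀ h k, B h k = B k h) :
    hessianMatrix (addQuadratic φ ξ c ℓ B) ξ
      = bilinMatrix (fderiv ℝ (fderiv ℝ φ) ξ + B) := by
  have h1 : fderiv ℝ (addQuadratic φ ξ c ℓ B) = fun x => fderiv ℝ φ x + (ℓ + B (x - ξ)) := by
    ext1 x
    have hs : HasFDerivAt (fun y : Euc N => y - ξ) (ContinuousLinearMap.id ℝ (Euc N)) x :=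
      (hasFDerivAt_id x).sub_const ξ
    have hφ' := (hφ.differentiable (by norm_num) x).hasFDerivAt
    have hℓ := ℓ.hasFDerivAt.comp x hs
    have hBB := ((B.hasFDerivAt.comp x hs).clm_apply hs).const_mul (1 / 2)
    refine (hφ'.add ((hℓ.const_add c).add hBB)).fderiv.trans ?_
    ext h
    simp [hB h x, hB h ξ]
    ring
  have hs : HasFDerivAt (fun y : Euc N => y - ξ) (ContinuousLinearMap.id ℝ (Euc N)) ξ :=
    (hasFDerivAt_id ξ).sub_const ξ
  have hφ' : HasFDerivAt (fderiv ℝ φ) (fderiv ℝ (fderiv ℝ φ) ξ) ξ :=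
    ((hφ.fderiv_right (m := 1) (by norm_num)).differentiable (by norm_num) ξ).hasFDerivAt
  rw [hessianMatrix_eq_bilinMatrix, h1]
  congr 1
  refine (hφ'.add ((B.hasFDerivAt.comp ξ hs).const_add ℓ)).fderiv.trans ?_
  rfl

theorem ViscSubsol.le_of_jet {f : Euc N → ℝ → ℝ} {u : Euc N → ℝ} (hF1 : IsF1 Ω F lam Lam)
    (hsub : ViscSubsol Ω (fun x r M => F x M - f x r) u) {φ : Euc N → ℝ}
    (hφ : ContDiff ℝ 2 φ) {ξ : Euc N} (hξ : ξ ∈ Ω) (ℓ : Euc N →L[ℝ] ℝ) {B : EucBilin N}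
    (hB : ∀ h k, B h k = B k h)
    (hjet : ∀ ε > 0, ∀ᶠ h in 𝓝 (0 : Euc N),
      u (ξ + h) ≤ u ξ + φ (ξ + h) - φ ξ + ℓ h + 1 / 2 * B h h + ε * ‖h‖ ^ 2) :
    f ξ (u ξ) ≤ F ξ (bilinMatrix (fderiv ℝ (fderiv ℝ φ) ξ + B)) := by
  have key : ∀ ε > 0, f ξ (u ξ)
      ≤ F ξ (bilinMatrix (fderiv ℝ (fderiv ℝ φ) ξ + B)) + ε * (Lam * N) := by
    intro ε hε
    have hBε : ∀ h k, (B + ε • innerBilin (Euc N)) h k = (B + ε • innerBilin (Euc N)) k h :=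
      fun h k => by simp [hB h k, real_inner_comm]
    have hD := fderiv_fderiv_symm hφ ξ
    have ht : Tendsto (fun x : Euc N => x - ξ) (𝓝 ξ) (𝓝 0) := by
      simpa using (continuous_sub_right ξ).tendsto ξ
    have h1 := hsub ξ hξ _ (contDiff_addQuadratic hφ ξ (u ξ - φ ξ) ℓ (B + ε • innerBilin (Euc N)))
      (by simp [addQuadratic]) ?_
    · rw [hessianMatrix_addQuadratic hφ ξ _ ℓ hBε] at h1
      have h2 := hF1.le_add_mul hξ (X := fderiv ℝ (fderiv ℝ φ) ξ + B)
        (Y := fderiv ℝ (fderiv ℝ φ) ξ + (B + ε • innerBilin (Euc N))) (c := ε)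
        (fun h k => by simp [hB h k, hD h k])
        (fun h k => by simp [hB h k, hD h k, real_inner_comm]) hε.le
        (fun h => by simp; linarith)
      linarith
    · refine Filter.Eventually.filter_mono nhdsWithin_le_nhds ?_
      filter_upwards [ht.eventually (hjet (ε / 2) (by positivity))] with x hx
      rw [add_sub_cancel] at hx
      simp only [addQuadratic, sub_self, map_zero, add_apply, smul_apply, innerBilin_apply,
        real_inner_self_eq_norm_sq, smul_eq_mul]
      linarith
  have hlim : Tendsto (fun ε : ℝ =>
      F ξ (bilinMatrix (fderiv ℝ (fderiv ℝ φ) ξ + B)) + ε * (Lam * N)) (𝓝[>] 0)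
      (𝓝 (F ξ (bilinMatrix (fderiv ℝ (fderiv ℝ φ) ξ + B)) + 0 * (Lam * N))) :=
    (Continuous.tendsto (by fun_prop) 0).mono_left nhdsWithin_le_nhds
  rw [zero_mul, add_zero] at hlim
  exact ge_of_tendsto hlim (by filter_upwards [self_mem_nhdsWithin] with ε hε using key ε hε)

theorem IsF1.neg (hF1 : IsF1 Ω F lam Lam) : IsF1 Ω (fun x M => -F x (-M)) lam Lam := by
  refine ⟨hF1.1, hF1.2.1, fun x hx X P hX hP => ?_⟩
  have h := hF1.2.2 x hx (-(X + P)) P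
    (hX.add (Matrix.isHermitian_iff_isSymm.1 hP.isHermitian)).neg hP
  rw [neg_add, neg_add_cancel_right, ← neg_add] at h
  constructor <;> linarith

theorem fderiv_fderiv_neg (φ : Euc N → ℝ) (x : Euc N) :
    fderiv ℝ (fderiv ℝ (-φ)) x = -fderiv ℝ (fderiv ℝ φ) x := by
  have h : fderiv ℝ (-φ) = -fderiv ℝ φ := by
    ext1 y
    exact fderiv_neg
  rw [h]
  exact fderiv_neg

theorem ViscSupersol.neg {g : Euc N → ℝ → ℝ} {v : Euc N → ℝ}
    (hsuper : ViscSupersol Ω (fun x r M => F x M - g x r) v) :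
    ViscSubsol Ω (fun x r M => -F x (-M) - -g x (-r)) (-v) := by
  intro x hx φ hφ h0 hmax
  have h := hsuper x hx (-φ) hφ.neg (by simpa using neg_eq_iff_eq_neg.1 h0) ?_
  · rw [hessianMatrix_eq_bilinMatrix, fderiv_fderiv_neg, bilinMatrix_neg,
      ← hessianMatrix_eq_bilinMatrix] at h
    simp only [Pi.neg_apply, neg_neg]
    linarith
  · filter_upwards [hmax] with y hy
    simp only [Pi.neg_apply] at hy ⊢
    linarith

theorem ViscSupersol.le_of_jet {g : Euc N → ℝ → ℝ} {v : Euc N → ℝ} (hF1 : IsF1 Ω F lam Lam)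
    (hsuper : ViscSupersol Ω (fun x r M => F x M - g x r) v) {η : Euc N} (hη : η ∈ Ω)
    (ℓ : Euc N →L[ℝ] ℝ) {B : EucBilin N} (hB : ∀ h k, B h k = B k h)
    (hjet : ∀ ε > 0, ∀ᶠ h in 𝓝 (0 : Euc N),
      -v (η + h) ≤ -v η + ℓ h + 1 / 2 * B h h + ε * ‖h‖ ^ 2) :
    F η (bilinMatrix (-B)) ≤ g η (v η) := by
  have h := hsuper.neg.le_of_jet (F := fun x M => -F x (-M)) (f := fun x r => -g x (-r))
    hF1.neg (φ := fun _ => 0) contDiff_const hη ℓ hB (fun ε hε => by simpa using hjet ε hε)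
  have h0 : fderiv ℝ (fderiv ℝ fun _ : Euc N => (0 : ℝ)) η = 0 := by simp
  rw [h0, zero_add] at h
  simp only [Pi.neg_apply, neg_neg] at h
  rw [bilinMatrix_neg]
  linarith

end BilinearMatrix

section Penalization

open Filter Metric

/-- The points almost maximizing `a ξ + b η - α / 2 * ‖ξ - η‖ ^ 2` converge, as `α → ∞`, to a strict
maximum point of `a + b`. -/
theorem tendsto_of_almost_max_doubling {H : Type*} [NormedAddCommGroup H] {B : Set H}
    (hB : IsCompact B) {a b : H → ℝ} (ha : UpperSemicontinuousOn a B)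
    (hb : UpperSemicontinuousOn b B) {x₀ : H} (hx₀ : x₀ ∈ B) {c : ℝ} (hc : 0 < c)
    (hmax : ∀ x ∈ B, a x + b x ≤ a x₀ + b x₀ - c * ‖x - x₀‖ ^ 2) {α τ : ℕ → ℝ}
    (hα : Tendsto α atTop atTop) (hτ : Tendsto τ atTop (𝓝 0)) {ξ η : ℕ → H}
    (hξ : ∀ n, ξ n ∈ B) (hη : ∀ n, η n ∈ B)
    (h : ∀ n, a x₀ + b x₀ ≤ a (ξ n) + b (η n) - α n / 2 * ‖ξ n - η n‖ ^ 2 + τ n) :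
    Tendsto ξ atTop (𝓝 x₀) ∧ Tendsto η atTop (𝓝 x₀) ∧
      Tendsto (fun n => α n * ‖ξ n - η n‖ ^ 2) atTop (𝓝 0) ∧
      Tendsto (fun n => a (ξ n)) atTop (𝓝 (a x₀)) ∧
      Tendsto (fun n => b (η n)) atTop (𝓝 (b x₀)) := by
  have hpos : ∀ᶠ n in atTop, 0 < α n := hα.eventually_gt_atTop 0
  obtain ⟨za, hza, hMa⟩ := ha.exists_isMaxOn ⟨x₀, hx₀⟩ hB
  obtain ⟨zb, hzb, hMb⟩ := hb.exists_isMaxOn ⟨x₀, hx₀⟩ hB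
  set M : ℝ := 2 * (a za + b zb - (a x₀ + b x₀) + 1) with hM
  have hsq : Tendsto (fun n => ‖ξ n - η n‖ ^ 2) atTop (𝓝 0) := by
    have hlim : Tendsto (fun n => M / α n) atTop (𝓝 0) := hα.const_div_atTop M
    refine squeeze_zero' (Eventually.of_forall fun n => by positivity) ?_ hlim
    filter_upwards [hpos, hτ.eventually_lt_const (zero_lt_one)] with n hn hτn
    rw [le_div_iff₀ hn]
    have h1 : a (ξ n) ≤ a za := hMa (hξ n)
    have h2 : b (η n) ≤ b zb := hMb (hη n)
    have h3 := h n
    linarith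
  have hdist : Tendsto (fun n => ξ n - η n) atTop (𝓝 0) := by
    rw [tendsto_zero_iff_norm_tendsto_zero]
    have := hsq.sqrt
    simpa [Real.sqrt_sq] using this
  have hξlim : Tendsto ξ atTop (𝓝 x₀) := by
    refine hB.tendsto_nhds_of_unique_mapClusterPt (Eventually.of_forall hξ) fun x hx hcl => ?_
    have hle : a x₀ + b x₀ ≤ a x + b x := by
      refine le_of_forall_pos_le_add fun δ hδ => ?_
      have h1 := eventually_nhdsWithin_iff.1 (ha x hx (a x + δ / 3) (by linarith))
      have h2 := eventually_nhdsWithin_iff.1 (hb x hx (b x + δ / 3) (by linarith))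
      have hsub : Tendsto (fun z : H × H => z.1 - z.2) (𝓝 x ×ˢ 𝓝 0) (𝓝 x) := by
        have hcont : Continuous fun z : H × H => z.1 - z.2 := by fun_prop
        simpa [nhds_prod_eq] using hcont.tendsto (x, 0)
      obtain ⟨P, hP, Q, hQ, hPQ⟩ := eventually_prod_iff.1 (hsub.eventually h2)
      obtain ⟨n, ⟨hn1, hn2⟩, hn3, hn4, hn5⟩ := ((mapClusterPt_iff_frequently.1 hcl _
        (h1.and hP)).and_eventually ((hdist.eventually hQ).and
          (hpos.and (hτ.eventually_lt_const (by linarith : 0 < δ / 3))))).exists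
      have h3 := hPQ hn2 hn3
      simp only [sub_sub_cancel] at h3
      have h4 := hn1 (hξ n)
      have h5 := h3 (hη n)
      have h6 := h n
      have h7 : 0 ≤ α n / 2 * ‖ξ n - η n‖ ^ 2 := by positivity
      linarith
    have h1 := hmax x hx
    have h2 : ‖x - x₀‖ ^ 2 ≤ 0 := by
      by_contra hlt
      push Not at hlt
      nlinarith
    have h3 : ‖x - x₀‖ = 0 := by
      have : ‖x - x₀‖ ^ 2 = 0 := le_antisymm h2 (by positivity)
      simpa using this
    exact sub_eq_zero.1 (norm_eq_zero.1 h3)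
  have hηlim : Tendsto η atTop (𝓝 x₀) := by
    have := hξlim.sub hdist
    simpa using this
  have hξB : Tendsto ξ atTop (𝓝[B] x₀) :=
    tendsto_nhdsWithin_iff.2 ⟨hξlim, Eventually.of_forall hξ⟩
  have hηB : Tendsto η atTop (𝓝[B] x₀) :=
    tendsto_nhdsWithin_iff.2 ⟨hηlim, Eventually.of_forall hη⟩
  have hau : ∀ δ > 0, ∀ᶠ n in atTop, a (ξ n) < a x₀ + δ := fun δ hδ =>
    hξB.eventually (ha x₀ hx₀ _ (by linarith))
  have hbu : ∀ δ > 0, ∀ᶠ n in atTop, b (η n) < b x₀ + δ := fun δ hδ =>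
    hηB.eventually (hb x₀ hx₀ _ (by linarith))
  refine ⟨hξlim, hηlim, ?_, ?_, ?_⟩
  · refine Metric.tendsto_nhds.2 fun δ hδ => ?_
    filter_upwards [hpos, hau (δ / 6) (by linarith), hbu (δ / 6) (by linarith),
      hτ.eventually_lt_const (by linarith : 0 < δ / 6)] with n h0 h1 h2 h3
    have h4 : 0 ≤ α n * ‖ξ n - η n‖ ^ 2 := by positivity
    rw [Real.dist_eq, sub_zero, abs_of_nonneg h4]
    linarith [h n]
  · refine Metric.tendsto_nhds.2 fun δ hδ => ?_
    filter_upwards [hpos, hau (δ / 6) (by linarith), hbu (δ / 6) (by linarith),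
      hτ.eventually_lt_const (by linarith : 0 < δ / 6)] with n h0 h1 h2 h3
    have h4 : 0 ≤ α n / 2 * ‖ξ n - η n‖ ^ 2 := by positivity
    rw [Real.dist_eq, abs_lt]
    constructor <;> linarith [h n]
  · refine Metric.tendsto_nhds.2 fun δ hδ => ?_
    filter_upwards [hpos, hau (δ / 6) (by linarith), hbu (δ / 6) (by linarith),
      hτ.eventually_lt_const (by linarith : 0 < δ / 6)] with n h0 h1 h2 h3
    have h4 : 0 ≤ α n / 2 * ‖ξ n - η n‖ ^ 2 := by positivity
    rw [Real.dist_eq, abs_lt]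
    constructor <;> linarith [h n]

end Penalization

section Difference

open Filter Metric

variable {N : ℕ} {Ω : Set (Euc N)} {F : Euc N → Matrix (Fin N) (Fin N) ℝ → ℝ} {lam Lam : ℝ}
  {f g : Euc N → ℝ → ℝ} {u v : Euc N → ℝ}

theorem eventually_fderiv_fderiv_le {φ : Euc N → ℝ} (hφ : ContDiff ℝ 2 φ) (x₀ : Euc N) {ε : ℝ}
    (hε : 0 < ε) : ∀ᶠ x in 𝓝 x₀, ∀ h, fderiv ℝ (fderiv ℝ φ) x h h
      ≤ fderiv ℝ (fderiv ℝ φ) x₀ h h + ε * ‖h‖ ^ 2 := by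
  have hcont : Continuous (fderiv ℝ (fderiv ℝ φ)) :=
    (hφ.fderiv_right (m := 1) (by norm_num)).continuous_fderiv (by norm_num)
  filter_upwards [hcont.tendsto x₀ (ball_mem_nhds (fderiv ℝ (fderiv ℝ φ) x₀) hε)] with x hx h
  have hlt : ‖fderiv ℝ (fderiv ℝ φ) x - fderiv ℝ (fderiv ℝ φ) x₀‖ < ε :=
    (dist_eq_norm (fderiv ℝ (fderiv ℝ φ) x) (fderiv ℝ (fderiv ℝ φ) x₀)).symm.trans_lt hx
  have h1 := (fderiv ℝ (fderiv ℝ φ) x - fderiv ℝ (fderiv ℝ φ) x₀).le_opNorm₂ h h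
  have h2 := (le_abs_self _).trans h1
  simp only [sub_apply] at h2
  have h3 : ‖fderiv ℝ (fderiv ℝ φ) x - fderiv ℝ (fderiv ℝ φ) x₀‖ * ‖h‖ * ‖h‖ ≤ ε * ‖h‖ * ‖h‖ := by
    gcongr
  nlinarith

/-- The subsolution inequality for `u - v` at pairs of nearby points produced by doubling the
variables. -/
theorem le_modulus_add_pucciSup_of_jets (hF1 : IsF1 Ω F lam Lam)
    (hsub : ViscSubsol Ω (fun x r M => F x M - f x r) u)
    (hsuper : ViscSupersol Ω (fun x r M => F x M - g x r) v) {ω : ℝ → ℝ}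
    (hω : ∀ α : ℝ, 0 < α → ∀ x ∈ Ω, ∀ y ∈ Ω, ∀ X Z : EucBilin N, (∀ h k, X h k = X k h) →
        (∀ h k, Z h k = Z k h) → (∀ h k, X h h + Z k k ≤ 3 * α * ‖h - k‖ ^ 2) →
        (∀ h, -(3 * α) * ‖h‖ ^ 2 ≤ X h h) → (∀ h, -(3 * α) * ‖h‖ ^ 2 ≤ Z h h) →
        F x (bilinMatrix X) - F y (bilinMatrix (-Z)) ≤ ω (α * ‖x - y‖ ^ 2 + ‖x - y‖))
    {φ : Euc N → ℝ} (hφ : ContDiff ℝ 2 φ) {x₀ ξ η : Euc N} (hξ : ξ ∈ Ω)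
    (hη : η ∈ Ω) {α κ c : ℝ} (hα : 0 < α) (hκ : 0 < κ) (hκα : κ ≤ α) (hc : 0 < c)
    (hD : ∀ h, fderiv ℝ (fderiv ℝ φ) ξ h h ≤ fderiv ℝ (fderiv ℝ φ) x₀ h h + c * ‖h‖ ^ 2)
    {p q : Euc N →L[ℝ] ℝ} {X Z : EucBilin N} (hX : ∀ h k, X h k = X k h)
    (hZ : ∀ h k, Z h k = Z k h)
    (hp : ∀ ε > 0, ∀ᶠ h in 𝓝 (0 : Euc N), u (ξ + h) - φ (ξ + h) - c * ‖ξ + h - x₀‖ ^ 2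
      ≤ u ξ - φ ξ - c * ‖ξ - x₀‖ ^ 2 + p h + 1 / 2 * X h h + ε * ‖h‖ ^ 2)
    (hq : ∀ ε > 0, ∀ᶠ h in 𝓝 (0 : Euc N),
      -v (η + h) ≤ -v η + q h + 1 / 2 * Z h h + ε * ‖h‖ ^ 2)
    (hXZ : ∀ h k, X h h + Z k k ≤ 2 * α * ‖h - k‖ ^ 2 + 2 * κ * (‖h‖ ^ 2 + ‖k‖ ^ 2))
    (hXl : ∀ h, -(20 * α) * ‖h‖ ^ 2 ≤ X h h) (hZl : ∀ h, -(20 * α) * ‖h‖ ^ 2 ≤ Z h h) :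
    f ξ (u ξ) - g η (v η) ≤ ω (10 * (α * ‖ξ - η‖ ^ 2) + ‖ξ - η‖)
      + pucciSup lam Lam (hessianMatrix φ x₀) + (3 * c + 4 * κ) * (Lam * N) := by
  have hDξ := fderiv_fderiv_symm hφ ξ
  have hD₀ := fderiv_fderiv_symm hφ x₀
  set J := innerBilin (Euc N) with hJ
  have hJs : ∀ h k, J h k = J k h := innerBilin_symm
  have hJn : ∀ h, J h h = ‖h‖ ^ 2 := fun h => real_inner_self_eq_norm_sq h
  have h1 : f ξ (u ξ) ≤ F ξ (bilinMatrix (fderiv ℝ (fderiv ℝ φ) ξ + (X + (2 * c) • J))) := by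
    refine hsub.le_of_jet hF1 hφ hξ (p + (2 * c) • innerSL ℝ (ξ - x₀))
      (fun h k => by simp [hX h k, hJs h k]) fun ε hε => ?_
    filter_upwards [hp ε hε] with h hh
    have e1 : ξ + h - x₀ = (ξ - x₀) + h := by abel
    rw [e1, norm_add_sq_real] at hh
    simp only [add_apply, smul_apply, innerSL_apply_apply, smul_eq_mul, hJn]
    linarith
  have h2 : F η (bilinMatrix (-Z)) ≤ g η (v η) := hsuper.le_of_jet hF1 hη q hZ hq
  have h3 := hω (10 * α) (by positivity) ξ hξ η hη (X - (2 * κ) • J) (Z - (2 * κ) • J)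
    (fun h k => by simp [hX h k, hJs h k]) (fun h k => by simp [hZ h k, hJs h k])
    (fun h k => by
      have := hXZ h k
      have : 0 ≤ α * ‖h - k‖ ^ 2 := by positivity
      simp only [sub_apply, smul_apply, smul_eq_mul, hJn]
      linarith)
    (fun h => by
      have := hXl h
      have : κ * ‖h‖ ^ 2 ≤ α * ‖h‖ ^ 2 := by gcongr
      have : 0 ≤ α * ‖h‖ ^ 2 := by positivity
      simp only [sub_apply, smul_apply, smul_eq_mul, hJn]
      linarith)
    (fun h => by
      have := hZl h
      have : κ * ‖h‖ ^ 2 ≤ α * ‖h‖ ^ 2 := by gcongr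
      have : 0 ≤ α * ‖h‖ ^ 2 := by positivity
      simp only [sub_apply, smul_apply, smul_eq_mul, hJn]
      linarith)
  have h4 : F ξ (bilinMatrix (fderiv ℝ (fderiv ℝ φ) ξ + (X + (2 * c) • J)))
      ≤ F ξ (bilinMatrix ((X - (2 * κ) • J) + fderiv ℝ (fderiv ℝ φ) x₀))
        + (3 * c + 2 * κ) * (Lam * N) := by
    refine hF1.le_add_mul hξ (fun h k => by simp [hX h k, hJs h k, hD₀ h k])
      (fun h k => by simp [hX h k, hJs h k, hDξ h k]) (by positivity) fun h => ?_
    have := hD h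
    simp only [add_apply, sub_apply, smul_apply, smul_eq_mul, hJn]
    linarith
  have h5 := hF1.le_add_pucciSup hξ (X := bilinMatrix (X - (2 * κ) • J))
    (M := bilinMatrix (fderiv ℝ (fderiv ℝ φ) x₀))
    (bilinMatrix_isSymm fun h k => by simp [hX h k, hJs h k]) (bilinMatrix_isSymm hD₀)
  rw [← bilinMatrix_add, ← hessianMatrix_eq_bilinMatrix] at h5
  have h6 : F η (bilinMatrix (-(Z - (2 * κ) • J)))
      ≤ F η (bilinMatrix (-Z)) + (2 * κ) * (Lam * N) := by
    refine hF1.le_add_mul hη (fun h k => by simp [hZ h k])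
      (fun h k => by simp [hZ h k, hJs h k]) (by positivity) fun h => ?_
    simp only [neg_apply, sub_apply, smul_apply, smul_eq_mul, hJn]
    linarith
  rw [mul_assoc] at h3
  linarith

end Difference

/-- if `u ∈ USC(Ω)` is a viscosity subsolution of `F(x,D²u) = f(x,u)` and
`v ∈ LSC(Ω)` a viscosity supersolution of `F(x,D²v) = g(x,v)` in `Ω`, then `w = u - v` is a
viscosity subsolution of `𝓜⁺(D²w) ≥ f(x,u) - g(x,v)` in `Ω`. -/
theorem statement10 {N : ℕ} (Ω : Set (Euc N))
    (F : Euc N → Matrix (Fin N) (Fin N) ℝ → ℝ) (lam Lam : ℝ)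
    (f g : Euc N → ℝ → ℝ) (u v : Euc N → ℝ)
    (hΩ_open : IsOpen Ω) (hΩ_bdd : IsBounded Ω) (hΩ_ne : Ω.Nonempty)
    (hΩ_conn : IsConnected Ω)
    (hFc : FCont Ω F) (hF1 : IsF1 Ω F lam Lam) (hF3 : IsF3 Ω F)
    (hf : ContinuousOn (fun q : Euc N × ℝ => f q.1 q.2) (Ω ×ˢ Set.univ))
    (hg : ContinuousOn (fun q : Euc N × ℝ => g q.1 q.2) (Ω ×ˢ Set.univ))
    (hu : UpperSemicontinuousOn u Ω) (hv : LowerSemicontinuousOn v Ω)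
    (hsub : ViscSubsol Ω (fun x r M => F x M - f x r) u)
    (hsuper : ViscSupersol Ω (fun x r M => F x M - g x r) v) :
    ∀ x₀ ∈ Ω, ∀ φ : Euc N → ℝ, ContDiff ℝ 2 φ → u x₀ - v x₀ = φ x₀ →
      IsLocalMaxOn (fun x => (u x - v x) - φ x) Ω x₀ →
      f x₀ (u x₀) - g x₀ (v x₀) ≤ pucciSup lam Lam (hessianMatrix φ x₀) := by
  intro x₀ hx₀ φ hφ h0 hmax
  obtain ⟨ω, hω0, hωc, hω⟩ := hF3.exists_modulus
  have hmax' : ∀ᶠ x in 𝓝 x₀, x ∈ Ω ∧ u x - v x - φ x ≤ u x₀ - v x₀ - φ x₀ := by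
    have h1 : ∀ᶠ x in 𝓝[Ω] x₀, u x - v x - φ x ≤ u x₀ - v x₀ - φ x₀ := hmax
    rw [hΩ_open.nhdsWithin_eq hx₀] at h1
    exact (hΩ_open.eventually_mem hx₀).and h1
  obtain ⟨R, hR, hball⟩ := Metric.nhds_basis_closedBall.eventually_iff.1 hmax'
  set B := Metric.closedBall x₀ R with hBdef
  have hBc : IsCompact B := isCompact_closedBall x₀ R
  have hx₀B : x₀ ∈ B := Metric.mem_closedBall_self hR.le
  have hBΩ : B ⊆ Ω := fun x hx => (hball hx).1
  have hBn : B ∈ 𝓝 x₀ := Metric.closedBall_mem_nhds x₀ hR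
  have hInt : ∀ᶠ x in 𝓝 x₀, ∀ᶠ h in 𝓝 (0 : Euc N), x + h ∈ B := by
    filter_upwards [eventually_mem_nhds_iff.2 hBn] with x hx
    have ht : Filter.Tendsto (fun h : Euc N => x + h) (𝓝 0) (𝓝 x) := by
      have hcont : Continuous fun h : Euc N => x + h := by fun_prop
      simpa using hcont.tendsto 0
    exact ht.eventually hx
  have hb : UpperSemicontinuousOn (fun x => -v x) B := by
    intro x hx y hy
    filter_upwards [hv.mono hBΩ x hx (-y) (by linarith)] with z hz
    linarith
  have key : ∀ c > 0, f x₀ (u x₀) - g x₀ (v x₀)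
      ≤ pucciSup lam Lam (hessianMatrix φ x₀) + 3 * c * (Lam * N) := by
    intro c hc
    have hcont : Continuous fun x : Euc N => -(φ x + c * ‖x - x₀‖ ^ 2) := by
      have := hφ.continuous
      fun_prop
    have ha : UpperSemicontinuousOn (fun x => u x - φ x - c * ‖x - x₀‖ ^ 2) B := by
      have h1 : (fun x => u x - φ x - c * ‖x - x₀‖ ^ 2)
          = fun x => u x + -(φ x + c * ‖x - x₀‖ ^ 2) := by
        ext x
        ring
      rw [h1]
      exact (hu.mono hBΩ).add (hcont.continuousOn.upperSemicontinuousOn (s := B))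
    have hjets := fun n : ℕ => exists_doubling_jets hBc ⟨x₀, hx₀B⟩ ha hb
      (α := (n : ℝ) + 1) (κ := 1 / ((n : ℝ) + 1)) (τ := 1 / ((n : ℝ) + 1)) (by positivity)
      (by positivity) (by
        have h1 : (1 : ℝ) ≤ (n : ℝ) + 1 := by linarith [n.cast_nonneg (α := ℝ)]
        exact ((div_le_one (by positivity)).2 h1).trans h1) (by positivity)
    choose ξ hξ η hη p q X Z hX hZ hM hp hq hXZ hXl hZl using hjets
    have hα : Filter.Tendsto (fun n : ℕ => (n : ℝ) + 1) Filter.atTop Filter.atTop :=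
      Filter.tendsto_atTop_add_const_right _ _ tendsto_natCast_atTop_atTop
    have hκ : Filter.Tendsto (fun n : ℕ => 1 / ((n : ℝ) + 1)) Filter.atTop (𝓝 0) :=
      tendsto_one_div_add_atTop_nhds_zero_nat
    obtain ⟨hξl, hηl, hαl, hul, hvl⟩ := tendsto_of_almost_max_doubling hBc ha hb hx₀B hc
      (fun x hx => by
        have := (hball hx).2
        simp only [sub_self, norm_zero]
        linarith) hα hκ hξ hη (fun n => by simpa using hM n x₀ hx₀B x₀ hx₀B)
    have hul' : Filter.Tendsto (fun n => u (ξ n)) Filter.atTop (𝓝 (u x₀)) := by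
      have := hul.sub ((hcont.tendsto x₀).comp hξl)
      convert this using 2
      · simp only [Function.comp_apply]; ring
      · ring
    have hvl' : Filter.Tendsto (fun n => v (η n)) Filter.atTop (𝓝 (v x₀)) := by
      simpa using hvl.neg
    have hlim : ∀ (k : Euc N → ℝ → ℝ) (y : ℕ → Euc N) (s : ℕ → ℝ) (r : ℝ),
        ContinuousOn (fun q : Euc N × ℝ => k q.1 q.2) (Ω ×ˢ Set.univ) →
        Filter.Tendsto y Filter.atTop (𝓝 x₀) → Filter.Tendsto s Filter.atTop (𝓝 r) →
        Filter.Tendsto (fun n => k (y n) (s n)) Filter.atTop (𝓝 (k x₀ r)) := by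
      intro k y s r hk hy hs
      have h1 := hk.continuousAt ((hΩ_open.prod isOpen_univ).mem_nhds
        (Set.mk_mem_prod hx₀ (Set.mem_univ r)))
      exact h1.tendsto.comp (hy.prodMk_nhds hs)
    have hle : ∀ᶠ n in Filter.atTop, f (ξ n) (u (ξ n)) - g (η n) (v (η n))
        ≤ ω (10 * (((n : ℝ) + 1) * ‖ξ n - η n‖ ^ 2) + ‖ξ n - η n‖)
          + pucciSup lam Lam (hessianMatrix φ x₀)
          + (3 * c + 4 * (1 / ((n : ℝ) + 1))) * (Lam * N) := by
      filter_upwards [hξl.eventually hInt, hηl.eventually hInt,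
        hξl.eventually (eventually_fderiv_fderiv_le hφ x₀ hc)] with n hξi hηi hDn
      refine le_modulus_add_pucciSup_of_jets (p := p n) (q := q n) hF1 hsub hsuper hω hφ
        (hBΩ (hξ n)) (hBΩ (hη n)) (by positivity) (by positivity) ?_ hc hDn (hX n) (hZ n)
        (fun ε hε => ?_) (fun ε hε => ?_)
        (hXZ n) (hXl n) (hZl n)
      · have h1 : (1 : ℝ) ≤ (n : ℝ) + 1 := by linarith [n.cast_nonneg (α := ℝ)]
        exact ((div_le_one (by positivity)).2 h1).trans h1
      · filter_upwards [hp n ε hε, hξi] with h hh hm using hh hm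
      · filter_upwards [hq n ε hε, hηi] with h hh hm using hh hm
    have hωl : Filter.Tendsto
        (fun n : ℕ => ω (10 * (((n : ℝ) + 1) * ‖ξ n - η n‖ ^ 2) + ‖ξ n - η n‖))
        Filter.atTop (𝓝 0) := by
      have h1 : Filter.Tendsto
          (fun n : ℕ => 10 * (((n : ℝ) + 1) * ‖ξ n - η n‖ ^ 2) + ‖ξ n - η n‖)
          Filter.atTop (𝓝 0) := by
        simpa using (hαl.const_mul 10).add (hξl.sub hηl).norm
      rw [← hω0]
      exact hωc.tendsto.comp h1
    have hrhs := (hωl.add_const (pucciSup lam Lam (hessianMatrix φ x₀))).add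
      (((hκ.const_mul 4).const_add (3 * c)).mul_const (Lam * N))
    have := le_of_tendsto_of_tendsto ((hlim f ξ _ _ hf hξl hul').sub (hlim g η _ _ hg hηl hvl'))
      hrhs hle
    simpa using this
  have hlim : Filter.Tendsto
      (fun c : ℝ => pucciSup lam Lam (hessianMatrix φ x₀) + 3 * c * (Lam * N)) (𝓝[>] 0)
      (𝓝 (pucciSup lam Lam (hessianMatrix φ x₀) + 3 * 0 * (Lam * N))) :=
    (Continuous.tendsto (by fun_prop) 0).mono_left nhdsWithin_le_nhds
  rw [mul_zero, zero_mul, add_zero] at hlim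
  exact ge_of_tendsto hlim (by filter_upwards [self_mem_nhdsWithin] with c hc using key c hc)
end
end

section
/- Let D > 0 and μ ∈ ℝ. There exists δ = δ(N, λ, Λ, μ, D) > 0 such that, for any bounded domain Ω ⊂ ℝ^N with diam(Ω) ≤ D and Lebesgue measure |Ω| ≤ δ, if v is a viscosity solution of 𝓜⁺(D²v)+μv ≥ 0 in Ω with v ≤ 0 on ∂Ω, then v ≤ 0 in Ω. -/
open scoped Matrix Topology
open Bornology MeasureTheory

noncomputable section

section TestFunction

variable {E : Type*} [NormedAddCommGroup E] [InnerProductSpace ℝ E]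

theorem hasFDerivAt_inner_sub (q x y : E) :
    HasFDerivAt (fun y : E => inner ℝ q (y - x)) (innerSL ℝ q) y :=
  (innerSL ℝ q).hasFDerivAt.comp y ((hasFDerivAt_id y).sub_const x)

theorem fderiv_quadratic (p e x : E) (a b c k : ℝ) :
    fderiv ℝ (fun y => c + inner ℝ p (y - x) - a * (k - inner ℝ e (y - x)) ^ 2
        + b * ‖y - x‖ ^ 2) = fun y =>
      innerSL ℝ (p + (2 * a * (k - inner ℝ e (y - x))) • e + (2 * b) • (y - x)) := by
  funext y
  have := (((hasFDerivAt_inner_sub p x y).const_add c).sub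
    ((((hasFDerivAt_inner_sub e x y).const_sub k).pow 2).const_mul a)).add
    (((hasFDerivAt_id y).sub_const x).norm_sq.const_mul b)
  refine HasFDerivAt.fderiv (this.congr_fderiv ?_)
  ext h
  simp
  ring

theorem fderiv_fderiv_quadratic (p e x : E) (a b c k : ℝ) (y h h' : E) :
    fderiv ℝ (fderiv ℝ (fun y => c + inner ℝ p (y - x) - a * (k - inner ℝ e (y - x)) ^ 2
        + b * ‖y - x‖ ^ 2)) y h h' =
      2 * b * inner ℝ h h' - 2 * a * (inner ℝ e h * inner ℝ e h') := by
  rw [fderiv_quadratic]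
  have h2 := (innerSL ℝ (E := E)).hasFDerivAt.comp y
    ((((((hasFDerivAt_inner_sub e x y).const_sub k).const_mul (2 * a)).smul_const e).const_add
      p).add (((hasFDerivAt_id y).sub_const x).const_smul (2 * b)))
  have h3 : fderiv ℝ (fun y => innerSL ℝ
      (p + (2 * a * (k - inner ℝ e (y - x))) • e + (2 * b) • (y - x))) y = _ := h2.fderiv
  rw [h3]
  change inner ℝ ((2 * a * -inner ℝ e h) • e + (2 * b) • h) h' = _
  rw [inner_add_left, real_inner_smul_left, real_inner_smul_left]
  ring

theorem contDiff_quadratic (p e x : E) (a b c k : ℝ) :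
    ContDiff ℝ 2 (fun y => c + inner ℝ p (y - x) - a * (k - inner ℝ e (y - x)) ^ 2
        + b * ‖y - x‖ ^ 2) := by
  have hd : ContDiff ℝ 2 fun y : E => y - x := contDiff_id.sub contDiff_const
  exact ((contDiff_const.add (contDiff_const.inner ℝ hd)).sub (contDiff_const.mul
    ((contDiff_const.sub (contDiff_const.inner ℝ hd)).pow 2))).add
    (contDiff_const.mul (hd.norm_sq ℝ))

end TestFunction

theorem hessianMatrix_quadratic {N : ℕ} (p e x : Euc N) (a b c k : ℝ) (y : Euc N) :
    hessianMatrix (fun y => c + inner ℝ p (y - x) - a * (k - inner ℝ e (y - x)) ^ 2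
        + b * ‖y - x‖ ^ 2) y =
      (2 * b) • (1 : Matrix (Fin N) (Fin N) ℝ) - (2 * a) • Matrix.vecMulVec e e := by
  ext i j
  rw [hessianMatrix, Matrix.of_apply, iteratedFDeriv_two_apply]
  refine (fderiv_fderiv_quadratic p e x a b c k y _ _).trans ?_
  simp [Matrix.one_apply, Matrix.vecMulVec_apply, EuclideanSpace.inner_single_right,
    eq_comm]

theorem pucciSup_le {N : ℕ} {lam Lam a b : ℝ} (hlL : lam ≤ Lam) (ha : 0 ≤ a) (hb : 0 ≤ b)
    (e : Euc N) (he : ‖e‖ = 1) :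
    pucciSup lam Lam ((2 * b) • (1 : Matrix (Fin N) (Fin N) ℝ)
      - (2 * a) • Matrix.vecMulVec e e) ≤ 2 * b * (N * Lam) - 2 * a * lam := by
  refine csSup_le ⟨_, lam • 1, ?_, ?_, ?_, rfl⟩ ?_
  · simp [Matrix.IsSymm]
  · simpa [MatLE] using Matrix.PosSemidef.zero
  · rw [MatLE, ← sub_smul]
    exact Matrix.PosSemidef.one.smul (sub_nonneg.2 hlL)
  · rintro _ ⟨A, -, h1, h2, rfl⟩
    have htr : A.trace ≤ N * Lam := by
      have := h2.trace_nonneg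
      simp [Matrix.trace_sub] at this
      linarith
    have hq : lam ≤ (e : Fin N → ℝ) ⬝ᵥ A *ᵥ (e : Fin N → ℝ) := by
      have h := h1.dotProduct_mulVec_nonneg (e : Fin N → ℝ)
      have hee : (e : Fin N → ℝ) ⬝ᵥ (e : Fin N → ℝ) = 1 := by
        have := EuclideanSpace.real_norm_sq_eq e
        rw [he] at this
        simp only [dotProduct, ← pow_two]
        linarith
      simp only [star_trivial, Matrix.sub_mulVec, dotProduct_sub, Matrix.smul_mulVec,
        Matrix.one_mulVec, dotProduct_smul, hee, smul_eq_mul, mul_one] at h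
      linarith
    have : (A * ((2 * b) • (1 : Matrix (Fin N) (Fin N) ℝ)
        - (2 * a) • Matrix.vecMulVec e e)).trace
        = 2 * b * A.trace - 2 * a * ((e : Fin N → ℝ) ⬝ᵥ A *ᵥ (e : Fin N → ℝ)) := by
      simp [Matrix.mul_sub, Matrix.trace_sub, Matrix.mul_vecMulVec, Matrix.trace_vecMulVec,
        dotProduct_comm]
    rw [this]
    gcongr

theorem exists_lipschitz_volume_image_le {N : ℕ} (hN : N ≠ 0) :
    ∃ ε : NNReal, 0 < ε ∧ ∀ (s : Set (Euc N)) (f : Euc N → Euc N),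
      LipschitzOnWith ε f s → volume (f '' s) ≤ volume s := by
  have : Nontrivial (Euc N) := by
    have : Nonempty (Fin N) := ⟨⟨0, Nat.pos_of_ne_zero hN⟩⟩
    infer_instance
  have hd : ENNReal.ofReal |(0 : Euc N →L[ℝ] Euc N).det| < (1 : NNReal) := by
    have : (0 : Euc N →L[ℝ] Euc N).det = 0 := by
      rw [ContinuousLinearMap.det, ContinuousLinearMap.toLinearMap_zero]
      exact LinearMap.det_zero''
    simp [this]
  obtain ⟨ε, h, hε⟩ := ((MeasureTheory.addHaar_image_le_mul_of_det_lt volume 0 hd).and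
    self_mem_nhdsWithin).exists
  refine ⟨ε, hε, fun s f hf => ?_⟩
  simpa using h s f (by
    intro x hx y hy
    simpa using hf.norm_sub_le hx hy)

theorem volume_image_le_of_locally {N : ℕ} {ε : NNReal}
    (hε : ∀ (s : Set (Euc N)) (f : Euc N → Euc N),
      LipschitzOnWith ε f s → volume (f '' s) ≤ volume s)
    {U A : Set (Euc N)} (hU : IsOpen U) (hAU : A ⊆ U) (f : Euc N → Euc N)
    (hf : ∀ x ∈ U, ∃ r > 0, LipschitzOnWith ε f (A ∩ Metric.ball x r)) :
    volume (f '' A) ≤ volume U := by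
  rcases U.eq_empty_or_nonempty with rfl | hne
  · simp [Set.subset_empty_iff.1 hAU]
  choose! r hr0 hr using hf
  obtain ⟨t, htU, htc, ht⟩ := TopologicalSpace.countable_cover_nhdsWithin
    (s := U) (f := fun x => Metric.ball x (r x))
    fun x hx => mem_nhdsWithin_of_mem_nhds (Metric.ball_mem_nhds x (hr0 x hx))
  have htne : t.Nonempty := by
    by_contra h
    simp [Set.not_nonempty_iff_eq_empty.1 h] at ht
    exact hne.ne_empty ht
  obtain ⟨c, rfl⟩ := htc.exists_eq_range htne
  set S : ℕ → Set (Euc N) := disjointed fun n => Metric.ball (c n) (r (c n)) with hS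
  have hSm : ∀ n, MeasurableSet (S n) := MeasurableSet.disjointed fun n => measurableSet_ball
  have hcov : U ⊆ ⋃ n, S n := by
    rw [hS, iUnion_disjointed]
    simpa using ht
  calc volume (f '' A) ≤ volume (⋃ n, f '' (A ∩ S n)) := by
        rw [← Set.image_iUnion, ← Set.inter_iUnion, Set.inter_eq_left.2 (hAU.trans hcov)]
    _ ≤ ∑' n, volume (f '' (A ∩ S n)) := measure_iUnion_le _
    _ ≤ ∑' n, volume (U ∩ S n) := by
        refine ENNReal.tsum_le_tsum fun n => (hε _ f ?_).trans
          (measure_mono (Set.inter_subset_inter_left _ hAU))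
        exact (hr _ (htU ⟨n, rfl⟩)).mono
          (Set.inter_subset_inter_right _ (disjointed_subset _ n))
    _ = volume (⋃ n, U ∩ S n) := by
        refine (measure_iUnion (fun i j hij => ?_) fun n => hU.measurableSet.inter (hSm n)).symm
        exact (disjoint_disjointed _ hij).mono Set.inter_subset_right Set.inter_subset_right
    _ ≤ volume U := measure_mono (Set.iUnion_subset fun _ => Set.inter_subset_left)

/-- Barrier estimate: if `v` lies below two affine functions of slopes `p` and `q`, touching the
first one at `x` and the second one at a point `x'` with `‖x - x'‖ ≤ d`, and if
`𝓜⁺(D²v) ≥ -K` near `x`, then `‖q - p‖` is at most of order `K * d`. -/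
theorem norm_slope_sub_le {N : ℕ} (hN : N ≠ 0) {lam Lam K : ℝ} (hlam : 0 < lam)
    (hlL : lam ≤ Lam) (hK : 0 ≤ K) {v : Euc N → ℝ} {x x' p q : Euc N} {d : ℝ}
    (hd : 0 < d) (hxx' : ‖x - x'‖ ≤ d)
    (hvc : ContinuousOn v (Metric.closedBall x ((32 * N * Lam / lam) * d)))
    (hp : ∀ y ∈ Metric.closedBall x ((32 * N * Lam / lam) * d), v y ≤ v x + inner ℝ p (y - x))
    (hq : ∀ y ∈ Metric.closedBall x ((32 * N * Lam / lam) * d), v y ≤ v x' + inner ℝ q (y - x'))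
    (hpx' : v x' ≤ v x + inner ℝ p (x' - x))
    (hv : ∀ y ∈ Metric.closedBall x ((32 * N * Lam / lam) * d), ∀ φ : Euc N → ℝ,
      ContDiff ℝ 2 φ → v y = φ y → IsLocalMax (fun z => v z - φ z) y →
        -K ≤ pucciSup lam Lam (hessianMatrix φ y)) :
    ‖q - p‖ ≤ 32 * K / lam * d := by
  set κ : ℝ := 32 * N * Lam / lam with hκ
  have hLam : 0 < Lam := hlam.trans_le hlL
  have hN1 : (1 : ℝ) ≤ N := by exact_mod_cast Nat.one_le_iff_ne_zero.2 hN
  have hκ32 : 32 ≤ κ := by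
    rw [hκ, le_div_iff₀ hlam]
    nlinarith
  rcases eq_or_ne q p with rfl | hne
  · simp only [sub_self, norm_zero]
    positivity
  set g : ℝ := ‖q - p‖ with hg
  have hg0 : 0 < g := norm_pos_iff.2 (sub_ne_zero.2 hne)
  set e : Euc N := g⁻¹ • (q - p) with he
  have he1 : ‖e‖ = 1 := by
    rw [he, norm_smul, norm_inv, norm_norm, ← hg]
    field_simp
  have hqp : q = p + g • e := by
    rw [he, smul_smul, mul_inv_cancel₀ hg0.ne', one_smul]
    abel
  set a : ℝ := g / (32 * d) with ha
  set b : ℝ := a * lam / (2 * N * Lam) with hb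
  have ha0 : 0 < a := by positivity
  have hb0 : 0 < b := by positivity
  have hga : g = 32 * a * d := by rw [ha]; field_simp
  have hbκ : b * κ ^ 2 = 16 * a * κ := by
    rw [hb, hκ]; field_simp; norm_num
  set φ : Euc N → ℝ := fun y => v x + inner ℝ p (y - x) - a * (2 * d - inner ℝ e (y - x)) ^ 2
        + b * ‖y - x‖ ^ 2 with hφ
  have hφ2 : ContDiff ℝ 2 φ := contDiff_quadratic _ _ _ _ _ _ _
  set S : Set (Euc N) := Metric.closedBall x (κ * d) ∩ {y | |inner ℝ e (y - x)| ≤ 2 * d} with hS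
  have hcs : Continuous fun y : Euc N => |inner ℝ e (y - x)| := by fun_prop
  have hScpt : IsCompact S :=
    (isCompact_closedBall _ _).inter_right (isClosed_le hcs continuous_const)
  have hxS : x ∈ S := ⟨Metric.mem_closedBall_self (by positivity), by simp; positivity⟩
  obtain ⟨y, hyS, hy⟩ := hScpt.exists_isMaxOn ⟨x, hxS⟩
    ((hvc.mono Set.inter_subset_left).sub hφ2.continuous.continuousOn)
  have hyx : 4 * a * d ^ 2 ≤ v y - φ y := by
    have := hy hxS
    change v x - φ x ≤ v y - φ y at this
    simp only [hφ, sub_self, inner_zero_right, norm_zero] at this ⊢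
    linarith
  set s : ℝ := inner ℝ e (y - x) with hs
  have hφy : φ y = v x + inner ℝ p (y - x) - a * (2 * d - s) ^ 2 + b * ‖y - x‖ ^ 2 := rfl
  have hpy := hp y hyS.1
  have hsle : |s| ≤ 2 * d := hyS.2
  have hqy : v y ≤ v x + inner ℝ p (y - x) + g * (s + d) := by
    have h1 := hq y hyS.1
    have h2 : |inner ℝ e (x - x')| ≤ d :=
      (abs_real_inner_le_norm _ _).trans (by rw [he1, one_mul]; exact hxx')
    have h3 : inner ℝ q (y - x') = inner ℝ p (y - x) - inner ℝ p (x' - x)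
        + g * (s + inner ℝ e (x - x')) := by
      rw [hqp, hs]
      simp only [inner_add_left, inner_smul_left, inner_sub_right]
      simp
      ring
    have h4 := mul_le_mul_of_nonneg_left (le_of_abs_le h2) hg0.le
    linarith
  have hn0 : 0 ≤ b * ‖y - x‖ ^ 2 := by positivity
  have hlt1 : s < 2 * d := by
    rcases (le_of_abs_le hsle).lt_or_eq with h | h
    · exact h
    · rw [h, sub_self] at hφy
      nlinarith [mul_pos ha0 (pow_pos hd 2)]
  have hlt2 : -(2 * d) < s := by
    rcases (neg_le_of_abs_le hsle).lt_or_eq with h | h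
    · exact h
    · rw [← h] at hφy hqy
      rw [hga] at hqy
      nlinarith [mul_pos ha0 (pow_pos hd 2)]
  have hlt3 : ‖y - x‖ < κ * d := by
    rcases (mem_closedBall_iff_norm.1 hyS.1).lt_or_eq with h | h
    · exact h
    · have h5 : b * ‖y - x‖ ^ 2 = 16 * a * κ * d ^ 2 := by
        rw [h, mul_pow, ← mul_assoc, hbκ]
      have h6 : (2 * d - s) ^ 2 ≤ 16 * d ^ 2 := by nlinarith
      have h7 := mul_le_mul_of_nonneg_left h6 ha0.le
      have h8 : 16 * a * 32 * d ^ 2 ≤ 16 * a * κ * d ^ 2 := by gcongr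
      nlinarith [mul_pos ha0 (pow_pos hd 2)]
  have hSn : S ∈ 𝓝 y := by
    refine Filter.inter_mem (Filter.mem_of_superset (Metric.isOpen_ball.mem_nhds
      (mem_ball_iff_norm.2 hlt3)) Metric.ball_subset_closedBall) ?_
    exact Filter.mem_of_superset ((isOpen_lt hcs continuous_const).mem_nhds
      (show |inner ℝ e (y - x)| < 2 * d from abs_lt.2 ⟨hlt2, hlt1⟩))
      fun _ => le_of_lt (α := ℝ)
  have key := hv y hyS.1
    (fun z => (v x + (v y - φ y)) + inner ℝ p (z - x) - a * (2 * d - inner ℝ e (z - x)) ^ 2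
        + b * ‖z - x‖ ^ 2) (contDiff_quadratic _ _ _ _ _ _ _) (by rw [hφy, hs]; ring)
    (by
      filter_upwards [hSn] with z hz
      have := hy hz
      change v z - φ z ≤ v y - φ y at this
      simp only [hφ] at this ⊢
      linarith)
  rw [hessianMatrix_quadratic] at key
  have hpu := pucciSup_le hlL ha0.le hb0.le e he1
  have hbN : 2 * b * (N * Lam) = a * lam := by rw [hb]; field_simp
  have hfin : a * lam ≤ K := by linarith
  rw [hga]
  have : a ≤ K / lam := (le_div_iff₀ hlam).2 hfin
  calc 32 * a * d ≤ 32 * (K / lam) * d := by gcongr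
    _ = 32 * K / lam * d := by ring

theorem exists_contact_point {N : ℕ} {Ω : Set (Euc N)} {D : ℝ} (hΩ : IsOpen Ω)
    (hb : IsBounded Ω) (hdiam : Metric.diam Ω ≤ D) {v : Euc N → ℝ}
    (hvc : ContinuousOn v (closure Ω)) (hbd : ∀ x ∈ frontier Ω, v x ≤ 0) {z : Euc N}
    (hz : z ∈ Ω) {p : Euc N} (hp : ‖p‖ * D < v z) :
    ∃ x ∈ Ω, 0 < v x ∧ ∀ y ∈ Ω, v y ≤ v x + inner ℝ p (y - x) := by
  have hcpt : IsCompact (closure Ω) := hb.isCompact_closure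
  have hpc : Continuous fun y : Euc N => inner ℝ p (y - z) := by fun_prop
  obtain ⟨x, hx, hmax⟩ := hcpt.exists_isMaxOn ⟨z, subset_closure hz⟩ (hvc.sub hpc.continuousOn)
  have hle : ∀ y ∈ Ω, v y ≤ v x + inner ℝ p (y - x) := fun y hy => by
    have h1 : v y - inner ℝ p (y - z) ≤ v x - inner ℝ p (x - z) := hmax (subset_closure hy)
    simp only [inner_sub_right] at h1 ⊢
    linarith
  have hpos : 0 < v x := by
    have h1 := hle z hz
    have h2 : ‖z - x‖ ≤ D := by
      rw [← dist_eq_norm]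
      refine (Metric.dist_le_diam_of_mem hb.closure (subset_closure hz) hx).trans ?_
      rwa [Metric.diam_closure]
    have h3 := (real_inner_le_norm p (z - x)).trans
      (mul_le_mul_of_nonneg_left h2 (norm_nonneg p))
    linarith
  refine ⟨x, ?_, hpos, hle⟩
  by_contra hxΩ
  exact (hbd x ⟨hx, by rwa [hΩ.interior_eq]⟩).not_gt hpos

/-- Consequence of the Alexandrov–Bakelman–Pucci method: a bounded open set carrying a subsolution
with positive maximum and nonpositive boundary values has volume bounded from below. -/
theorem volume_ball_le_of_pos_max {N : ℕ} (hN : N ≠ 0) {ε : NNReal} (hε0 : 0 < ε)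
    (hε : ∀ (s : Set (Euc N)) (f : Euc N → Euc N),
      LipschitzOnWith ε f s → volume (f '' s) ≤ volume s)
    {lam Lam μ D : ℝ} (hlam : 0 < lam) (hlL : lam ≤ Lam) (hD : 0 < D)
    {Ω : Set (Euc N)} (hΩ : IsOpen Ω) (hb : IsBounded Ω) (hdiam : Metric.diam Ω ≤ D)
    {v : Euc N → ℝ} (hvc : ContinuousOn v (closure Ω))
    (hv : ViscSubsol Ω (fun _ r M => pucciSup lam Lam M + μ * r) v)
    (hbd : ∀ x ∈ frontier Ω, v x ≤ 0) {z : Euc N} (hz : z ∈ Ω) (hvz : 0 < v z)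
    (hmax : ∀ y ∈ Ω, v y ≤ v z) :
    volume (Metric.ball (0 : Euc N) (ε * lam / (32 * (|μ| + 1) * D))) ≤ volume Ω := by
  set U : Set (Euc N) := Ω ∩ v ⁻¹' Set.Ioi 0 with hU
  have hUo : IsOpen U := (hvc.mono subset_closure).isOpen_inter_preimage hΩ isOpen_Ioi
  set P : ℝ := v z / D with hP
  have hμ : 0 < |μ| + 1 := by positivity
  set K : ℝ := (|μ| + 1) * v z with hK
  have hK0 : 0 < K := by positivity
  set L : ℝ := 32 * K / lam with hL
  have hL0 : 0 < L := by positivity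
  set κ : ℝ := 32 * N * Lam / lam with hκ
  have hκ0 : 0 < κ := by have := hlam.trans_le hlL; positivity
  have hcontact : ∀ p ∈ Metric.ball (0 : Euc N) P,
      ∃ x, x ∈ U ∧ ∀ y ∈ Ω, v y ≤ v x + inner ℝ p (y - x) := by
    intro p hp
    rw [mem_ball_zero_iff, hP, lt_div_iff₀ hD] at hp
    obtain ⟨x, hx, hx0, h⟩ := exists_contact_point hΩ hb hdiam hvc hbd hz hp
    exact ⟨x, ⟨hx, hx0⟩, h⟩
  choose! X hXU hX using hcontact
  have hvisc : ∀ y ∈ U, ∀ φ : Euc N → ℝ, ContDiff ℝ 2 φ → v y = φ y →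
      IsLocalMax (fun w => v w - φ w) y → -K ≤ pucciSup lam Lam (hessianMatrix φ y) := by
    intro y hy φ hφ hvφ hm
    have h1 := hv y hy.1 φ hφ hvφ (hm.on Ω)
    have h2 : μ * v y ≤ K := by
      have h0 : 0 ≤ v y := le_of_lt hy.2
      calc μ * v y ≤ (|μ| + 1) * v y := by
            gcongr; linarith [le_abs_self μ]
        _ ≤ K := by rw [hK]; gcongr; exact hmax y hy.1
    simp only at h1
    linarith
  have hloc : ∀ x ∈ U, ∃ r > 0, ∀ p ∈ Metric.ball (0 : Euc N) P,
      ∀ q ∈ Metric.ball (0 : Euc N) P, X p ∈ Metric.ball x r → X q ∈ Metric.ball x r →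
        ‖q - p‖ ≤ L * ‖X p - X q‖ := by
    intro x hx
    obtain ⟨R, hR, hRU⟩ := Metric.isOpen_iff.1 hUo x hx
    refine ⟨R / (1 + 2 * κ), by positivity, fun p hp q hq hXp hXq => ?_⟩
    set r := R / (1 + 2 * κ) with hr
    have hrR : r + κ * (2 * r) = R := by rw [hr]; field_simp
    have hd2 : ‖X p - X q‖ < 2 * r := by
      rw [← dist_eq_norm]
      have := dist_triangle_right (X p) (X q) x
      rw [Metric.mem_ball] at hXp hXq
      linarith
    have hbound : ∀ d, ‖X p - X q‖ < d → d < 2 * r → ‖q - p‖ ≤ L * d := by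
      intro d hd hdr
      have hsub : Metric.closedBall (X p) (κ * d) ⊆ U := by
        refine (Metric.closedBall_subset_ball' ?_).trans hRU
        rw [Metric.mem_ball] at hXp
        have : κ * d ≤ κ * (2 * r) := by gcongr
        linarith
      exact norm_slope_sub_le hN hlam hlL hK0.le ((norm_nonneg _).trans_lt hd) hd.le
        (hvc.mono (hsub.trans (Set.inter_subset_left.trans subset_closure)))
        (fun y hy => hX p hp y (hsub hy).1) (fun y hy => hX q hq y (hsub hy).1)
        (hX p hp _ (hXU q hq).1) (fun y hy => hvisc y (hsub hy))
    rw [← div_le_iff₀' hL0]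
    refine le_of_forall_gt_imp_ge_of_dense fun d hd => ?_
    rw [div_le_iff₀' hL0]
    obtain ⟨d', hd', hd''⟩ := exists_between (lt_min hd hd2)
    exact (hbound d' hd' (hd''.trans_le (min_le_right _ _))).trans
      (mul_le_mul_of_nonneg_left (hd''.le.trans (min_le_left _ _)) hL0.le)
  set t : ℝ := ε / L with ht
  have ht0 : 0 < t := by positivity
  set Y : Euc N → Euc N := Function.invFunOn X (Metric.ball 0 P) with hY
  set A : Set (Euc N) := X '' Metric.ball 0 P with hA
  have hYA : ∀ x ∈ A, Y x ∈ Metric.ball (0 : Euc N) P ∧ X (Y x) = x := fun x hx =>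
    ⟨Function.invFunOn_mem hx, Function.invFunOn_eq hx⟩
  have hAU : A ⊆ U := Set.image_subset_iff.2 hXU
  have hlip : ∀ x ∈ U, ∃ r > 0,
      LipschitzOnWith ε (fun y => t • Y y) (A ∩ Metric.ball x r) := by
    intro x hx
    obtain ⟨r, hr, h⟩ := hloc x hx
    refine ⟨r, hr, LipschitzOnWith.of_dist_le_mul fun y hy w hw => ?_⟩
    obtain ⟨hy1, hy2⟩ := hYA y hy.1
    obtain ⟨hw1, hw2⟩ := hYA w hw.1
    have := h _ hw1 _ hy1 (hw2.symm ▸ hw.2) (hy2.symm ▸ hy.2)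
    rw [hy2, hw2] at this
    rw [dist_eq_norm, dist_comm, dist_eq_norm, ← smul_sub, norm_smul, Real.norm_of_nonneg ht0.le]
    calc t * ‖Y y - Y w‖ ≤ t * (L * ‖w - y‖) := by gcongr
      _ = ε * ‖w - y‖ := by rw [ht]; field_simp
  refine le_trans (measure_mono ?_) ((volume_image_le_of_locally hε hUo hAU _ hlip).trans
    (measure_mono Set.inter_subset_left))
  intro w hw
  have hp : t⁻¹ • w ∈ Metric.ball (0 : Euc N) P := by
    rw [mem_ball_zero_iff] at hw ⊢
    rw [norm_smul, norm_inv, Real.norm_of_nonneg ht0.le, inv_mul_lt_iff₀ ht0]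
    refine hw.trans_eq ?_
    rw [ht, hL, hK, hP]
    field_simp
  have hXA : X (t⁻¹ • w) ∈ A := Set.mem_image_of_mem X hp
  obtain ⟨h1, h2⟩ := hYA _ hXA
  obtain ⟨r, hr, h⟩ := hloc _ (hXU _ hp)
  have h3 := h _ hp _ h1 (Metric.mem_ball_self hr) (by rw [h2]; exact Metric.mem_ball_self hr)
  rw [h2, sub_self, norm_zero, mul_zero] at h3
  refine ⟨_, hXA, ?_⟩
  beta_reduce
  rw [sub_eq_zero.1 (norm_le_zero_iff.1 h3), smul_inv_smul₀ ht0.ne']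

theorem exists_pos_max_of_pos {N : ℕ} {Ω : Set (Euc N)} (hΩ : IsOpen Ω) (hb : IsBounded Ω)
    {v : Euc N → ℝ} (hvc : ContinuousOn v (closure Ω)) (hbd : ∀ x ∈ frontier Ω, v x ≤ 0)
    {x : Euc N} (hx : x ∈ Ω) (hvx : 0 < v x) :
    ∃ z ∈ Ω, 0 < v z ∧ ∀ y ∈ Ω, v y ≤ v z := by
  obtain ⟨z, hz, hmax⟩ := hb.isCompact_closure.exists_isMaxOn ⟨x, subset_closure hx⟩ hvc
  have hvz : 0 < v z := hvx.trans_le (hmax (subset_closure hx))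
  refine ⟨z, ?_, hvz, fun y hy => hmax (subset_closure hy)⟩
  by_contra hzΩ
  exact (hbd z ⟨hz, by rwa [hΩ.interior_eq]⟩).not_gt hvz

/-- maximum principle in small domains: given `D > 0` and `μ ∈ ℝ`, there is
`δ = δ(N, lam, Lam, μ, D) > 0` such that for every bounded domain `Ω` with `diam Ω ≤ D` and
`|Ω| ≤ δ`, any viscosity subsolution `v` of `𝓜⁺(D²v) + μv ≥ 0` in `Ω` with `v ≤ 0` on `∂Ω`
satisfies `v ≤ 0` in `Ω`. -/
theorem statement11 (N : ℕ) (lam Lam μ D : ℝ)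
    (hlam : 0 < lam) (hlL : lam ≤ Lam) (hD : 0 < D) :
    ∃ δ : ℝ, 0 < δ ∧
      ∀ Ω : Set (Euc N), IsOpen Ω → IsBounded Ω → Ω.Nonempty → IsConnected Ω →
        Metric.diam Ω ≤ D → volume Ω ≤ ENNReal.ofReal δ →
        ∀ v : Euc N → ℝ, ContinuousOn v (closure Ω) →
          ViscSubsol Ω (fun x r M => pucciSup lam Lam M + μ * r) v →
          (∀ x ∈ frontier Ω, v x ≤ 0) → ∀ x ∈ Ω, v x ≤ 0 := by
  obtain ⟨η, hη, h⟩ : ∃ η : ℝ, 0 < η ∧ ∀ Ω : Set (Euc N), IsOpen Ω → IsBounded Ω →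
      Metric.diam Ω ≤ D → ∀ v : Euc N → ℝ, ContinuousOn v (closure Ω) →
        ViscSubsol Ω (fun _ r M => pucciSup lam Lam M + μ * r) v →
        (∀ x ∈ frontier Ω, v x ≤ 0) → ∀ x ∈ Ω, 0 < v x →
          volume (Metric.ball (0 : Euc N) η) ≤ volume Ω := by
    rcases eq_or_ne N 0 with rfl | hN
    · refine ⟨1, one_pos, fun Ω _ _ _ v _ _ _ x hx _ => measure_mono fun y _ => ?_⟩
      rwa [Subsingleton.elim y x]
    · obtain ⟨ε, hε0, hε⟩ := exists_lipschitz_volume_image_le hN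
      refine ⟨ε * lam / (32 * (|μ| + 1) * D), by positivity,
        fun Ω hΩ hb hdiam v hvc hv hbd x hx hvx => ?_⟩
      obtain ⟨z, hz, hvz, hmax⟩ := exists_pos_max_of_pos hΩ hb hvc hbd hx hvx
      exact volume_ball_le_of_pos_max hN hε0 hε hlam hlL hD hΩ hb hdiam hvc hv hbd hz hvz hmax
  have hpos : 0 < volume (Metric.ball (0 : Euc N) η) := Metric.measure_ball_pos _ _ hη
  obtain ⟨δ, hδ0, hδ⟩ := ENNReal.lt_iff_exists_nnreal_btwn.1 hpos
  refine ⟨δ, by exact_mod_cast hδ0, fun Ω hΩ hb _ _ hdiam hvol v hvc hv hbd x hx => ?_⟩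
  by_contra! hvx
  rw [ENNReal.ofReal_coe_nnreal] at hvol
  exact (h Ω hΩ hb hdiam v hvc hv hbd x hx hvx).not_gt (hvol.trans_lt hδ)
end
end
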